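/- Let 0 < α < 1 and 1 < p < ∞. There exists a constant c > 0 such that for every f ∈ Λ_α(ℝ), all bounded self-adjoint operators A and B on a separable Hilbert space, and every bounded operator Q with AQ − QB ∈ S_p, the quasicommutator f(A)Q − Qf(B) belongs to S_{p/α} and ‖f(A)Q − Qf(B)‖_{S_{p/α}} ≤ c · ‖f‖_{Λ_α(ℝ)} · ‖Q‖^{1−α} · ‖AQ − QB‖_{S_p}^α. -/

import Mathlib

open scoped BigOperators
noncomputable section

/-- The `j`-th singular value of a bounded operator `T` on a Hilbert space:
`s_j(T) = inf {‖T - R‖ : rank R ≤ j}`. -/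
def sVal {H : Type} [NormedAddCommGroup H] [InnerProductSpace ℂ H] [CompleteSpace H]
    (T : H →L[ℂ] H) (j : ℕ) : ℝ :=
  sInf {c : ℝ | ∃ R : H →L[ℂ] H, LinearMap.rank (R : H →ₗ[ℂ] H) ≤ (j : Cardinal) ∧ c = ‖T - R‖}

/-- Membership in the Schatten–von Neumann class `S_p`. -/
def MemSchatten {H : Type} [NormedAddCommGroup H] [InnerProductSpace ℂ H] [CompleteSpace H]
    (p : ℝ) (T : H →L[ℂ] H) : Prop :=
  Summable fun j : ℕ => sVal T j ^ p

/-- The Schatten–von Neumann norm `‖T‖_{S_p} = (∑_{j ≥ 0} s_j(T)^p)^{1/p}`. -/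
def schNorm {H : Type} [NormedAddCommGroup H] [InnerProductSpace ℂ H] [CompleteSpace H]
    (p : ℝ) (T : H →L[ℂ] H) : ℝ :=
  (∑' j : ℕ, sVal T j ^ p) ^ (1 / p)

/-- `f` satisfies the Hölder condition of order `α` with constant `C`. -/
def HoelderWith (C α : ℝ) (f : ℝ → ℂ) : Prop :=
  ∀ x y : ℝ, ‖f x - f y‖ ≤ C * |x - y| ^ α

/-- The Hölder norm `‖f‖_{Λ_α(ℝ)} = sup_{x ≠ y} |f(x) - f(y)|/|x - y|^α`, realized as the least
admissible Hölder constant. -/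
def hoelderNorm (α : ℝ) (f : ℝ → ℂ) : ℝ :=
  sInf {C : ℝ | 0 ≤ C ∧ HoelderWith C α f}

/-- Membership in the Hölder class `Λ_α(ℝ)`. -/
def MemHoelder (α : ℝ) (f : ℝ → ℂ) : Prop := ∃ C : ℝ, 0 ≤ C ∧ HoelderWith C α f

/-- `f(A)` for a bounded self-adjoint operator `A` (whose spectrum is real), via the continuous
functional calculus. -/
def opFun {H : Type} [NormedAddCommGroup H] [InnerProductSpace ℂ H] [CompleteSpace H]
    (f : ℝ → ℂ) (A : H →L[ℂ] H) : H →L[ℂ] H :=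
  cfc (fun z : ℂ => f z.re) A

section SingularValues

set_option linter.unusedSectionVars false

variable {H : Type} [NormedAddCommGroup H] [InnerProductSpace ℂ H] [CompleteSpace H]

lemma sVal_le (T : H →L[ℂ] H) {j : ℕ} {R : H →L[ℂ] H}
    (hR : LinearMap.rank (R : H →ₗ[ℂ] H) ≤ (j : Cardinal)) : sVal T j ≤ ‖T - R‖ :=
  csInf_le ⟨0, by rintro _ ⟨R, -, rfl⟩; exact norm_nonneg _⟩ ⟨R, hR, rfl⟩

lemma sVal_nonempty (T : H →L[ℂ] H) (j : ℕ) :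
    {c : ℝ | ∃ R : H →L[ℂ] H, LinearMap.rank (R : H →ₗ[ℂ] H) ≤ (j : Cardinal) ∧
      c = ‖T - R‖}.Nonempty :=
  ⟨‖T - 0‖, 0, by simp, rfl⟩

lemma sVal_nonneg (T : H →L[ℂ] H) (j : ℕ) : 0 ≤ sVal T j :=
  le_csInf (sVal_nonempty T j) (by rintro _ ⟨R, -, rfl⟩; exact norm_nonneg _)

lemma exists_rank_le_norm_sub_lt (T : H →L[ℂ] H) (j : ℕ) {c : ℝ} (hc : sVal T j < c) :
    ∃ R : H →L[ℂ] H, LinearMap.rank (R : H →ₗ[ℂ] H) ≤ (j : Cardinal) ∧ ‖T - R‖ < c := by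
  obtain ⟨_, ⟨R, hR, rfl⟩, h⟩ := exists_lt_of_csInf_lt (sVal_nonempty T j) hc
  exact ⟨R, hR, h⟩

lemma sVal_antitone (T : H →L[ℂ] H) : Antitone (sVal T) := by
  intro i j hij
  refine le_csInf (sVal_nonempty T i) ?_
  rintro _ ⟨R, hR, rfl⟩
  exact sVal_le T (hR.trans (by exact_mod_cast hij))

lemma rank_sub_le_nat {R S : H →L[ℂ] H} {m n : ℕ}
    (hR : LinearMap.rank (R : H →ₗ[ℂ] H) ≤ (m : Cardinal))
    (hS : LinearMap.rank (S : H →ₗ[ℂ] H) ≤ (n : Cardinal)) :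
    LinearMap.rank ((R - S : H →L[ℂ] H) : H →ₗ[ℂ] H) ≤ ((m + n : ℕ) : Cardinal) := by
  have hneg : LinearMap.rank (-(S : H →ₗ[ℂ] H)) ≤ (n : Cardinal) := by
    have h : -(S : H →ₗ[ℂ] H) = (-LinearMap.id).comp (S : H →ₗ[ℂ] H) := by ext; simp
    rw [h]
    exact (LinearMap.rank_comp_le_right _ _).trans hS
  have h : ((R - S : H →L[ℂ] H) : H →ₗ[ℂ] H) = (R : H →ₗ[ℂ] H) + -(S : H →ₗ[ℂ] H) := by
    ext; simp [sub_eq_add_neg]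
  rw [h]
  push_cast
  exact (LinearMap.rank_add_le _ _).trans (add_le_add hR hneg)

/-- A finite-rank operator is a sum of at most `rank R` elementary operators. -/
lemma exists_eq_sum_rankOne {R : H →L[ℂ] H} {r : ℕ}
    (hR : LinearMap.rank (R : H →ₗ[ℂ] H) ≤ (r : Cardinal)) :
    ∃ (n : ℕ) (x y : Fin n → H), n ≤ r ∧ (∀ i, ‖x i‖ ≤ 1) ∧ (∀ i, ‖y i‖ ≤ ‖R‖) ∧
      R = ∑ i, InnerProductSpace.rankOne ℂ (x i) (y i) := by
  have hfin : FiniteDimensional ℂ (LinearMap.range (R : H →ₗ[ℂ] H)) :=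
    Module.rank_lt_aleph0_iff.mp (hR.trans_lt (Cardinal.natCast_lt_aleph0))
  set V := LinearMap.range (R : H →ₗ[ℂ] H) with hV
  let b := stdOrthonormalBasis ℂ V
  refine ⟨_, fun i => (b i : H), fun i => ContinuousLinearMap.adjoint R (b i : H), ?_, ?_, ?_, ?_⟩
  · have : Module.rank ℂ V ≤ (r : Cardinal) := hR
    rw [← Module.finrank_eq_rank] at this
    exact_mod_cast this
  · intro i
    exact (b.norm_eq_one i).le
  · intro i
    refine (ContinuousLinearMap.le_opNorm _ _).trans ?_
    have : ‖(b i : H)‖ = 1 := b.norm_eq_one i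
    rw [this, mul_one, LinearIsometryEquiv.norm_map]
  · ext z
    have hz : R z ∈ V := ⟨z, rfl⟩
    have h := congrArg (Subtype.val) (b.sum_repr' (⟨R z, hz⟩ : V))
    simp only [Submodule.coe_sum, Submodule.coe_smul, Submodule.coe_inner] at h
    simp only [_root_.sum_apply, InnerProductSpace.rankOne_apply,
      ContinuousLinearMap.adjoint_inner_left]
    exact h.symm

lemma rank_starProjection_span_le {m : ℕ} (e : Fin m → H)
    [(Submodule.span ℂ (Set.range e)).HasOrthogonalProjection] :
    LinearMap.rank (((Submodule.span ℂ (Set.range e)).starProjection : H →L[ℂ] H) : H →ₗ[ℂ] H)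
      ≤ (m : Cardinal) := by
  rw [LinearMap.rank]
  have : LinearMap.range (((Submodule.span ℂ (Set.range e)).starProjection : H →L[ℂ] H) : H →ₗ[ℂ] H)
      = Submodule.span ℂ (Set.range e) := by
    exact Submodule.range_starProjection _
  rw [this]
  refine (rank_span_le _).trans ?_
  simpa using Cardinal.mk_range_le (f := e)

/-- If `T` is farther than `c` from all operators of rank `≤ 2 j`, then there are orthonormal
systems of length `j + 1` on which the diagonal of `T` exceeds `c`. -/
lemma exists_orthonormal_lt_inner (T : H →L[ℂ] H) {c : ℝ} (hc : 0 ≤ c) (j : ℕ)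
    (hT : c < sVal T (2 * j)) :
    ∀ m ≤ j + 1, ∃ e f : Fin m → H, Orthonormal ℂ e ∧ Orthonormal ℂ f ∧
      ∀ k, c ≤ (inner ℂ (f k) (T (e k))).re := by
  intro m
  induction m with
  | zero =>
    intro _
    exact ⟨Fin.elim0, Fin.elim0, ⟨fun i => i.elim0, fun i => i.elim0⟩,
      ⟨fun i => i.elim0, fun i => i.elim0⟩, fun i => i.elim0⟩
  | succ m ih =>
    intro hm
    obtain ⟨e, f, he, hf, hef⟩ := ih (by omega)
    set E := Submodule.span ℂ (Set.range e) with hE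
    set F := Submodule.span ℂ (Set.range f) with hF
    have : FiniteDimensional ℂ E := FiniteDimensional.span_of_finite ℂ (Set.finite_range e)
    have : FiniteDimensional ℂ F := FiniteDimensional.span_of_finite ℂ (Set.finite_range f)
    set PE : H →L[ℂ] H := E.starProjection with hPE
    set PF : H →L[ℂ] H := F.starProjection with hPF
    set S : H →L[ℂ] H := (1 - PF) * T * (1 - PE) with hS
    have hnorm : c < ‖S‖ := by
      refine hT.trans_le ?_
      have hrank : LinearMap.rank ((PF * T - (PF - 1) * T * PE : H →L[ℂ] H) : H →ₗ[ℂ] H)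
          ≤ ((2 * j : ℕ) : Cardinal) := by
        refine (rank_sub_le_nat (m := m) (n := m) ?_ ?_).trans (by exact_mod_cast (by omega))
        · exact (LinearMap.rank_comp_le_left _ _).trans (rank_starProjection_span_le f)
        · exact (LinearMap.rank_comp_le_right _ _).trans (rank_starProjection_span_le e)
      have h := sVal_le T hrank
      have h2 : T - (PF * T - (PF - 1) * T * PE) = S := by
        rw [hS]; noncomm_ring
      rwa [h2] at h
    obtain ⟨x, hx⟩ : ∃ x, c * ‖x‖ < ‖S x‖ := by
      by_contra! h
      exact absurd (ContinuousLinearMap.opNorm_le_bound S hc h) (not_le.mpr hnorm)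
    set y := x - PE x with hy
    set z := T y - PF (T y) with hz
    have hSx : S x = z := rfl
    have hyE : ∀ k, inner ℂ (e k) y = 0 := fun k =>
      Submodule.inner_right_of_mem_orthogonal (Submodule.subset_span (Set.mem_range_self k))
        (Submodule.sub_starProjection_mem_orthogonal x)
    have hzF' : z ∈ Fᗮ := Submodule.sub_starProjection_mem_orthogonal (T y)
    have hzF : ∀ k, inner ℂ (f k) z = 0 := fun k =>
      Submodule.inner_right_of_mem_orthogonal (Submodule.subset_span (Set.mem_range_self k)) hzF'
    have hyx : ‖y‖ ≤ ‖x‖ := by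
      have h : y = Eᗮ.starProjection x := by
        rw [Submodule.starProjection_orthogonal']; rfl
      rw [h]
      exact Submodule.norm_starProjection_apply_le _ _
    rw [hSx] at hx
    have hzpos : 0 < ‖z‖ := (by positivity : 0 ≤ c * ‖x‖).trans_lt hx
    have hypos : 0 < ‖y‖ := by
      rw [norm_pos_iff]
      intro h0
      have : z = 0 := by rw [hz, h0]; simp
      simp [this] at hzpos
    have hzTy : inner ℂ z (T y) = (‖z‖ : ℂ) ^ 2 := by
      have h1 : T y = z + PF (T y) := by rw [hz]; abel
      have h2 : inner ℂ z (PF (T y)) = 0 :=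
        Submodule.inner_left_of_mem_orthogonal (Submodule.starProjection_apply_mem _ _) hzF'
      rw [h1, inner_add_right, h2, add_zero, inner_self_eq_norm_sq_to_K]
      rfl
    have snoc : ∀ {w : Fin m → H} {v : H}, Orthonormal ℂ w → (∀ k, inner ℂ (w k) v = 0) →
        0 < ‖v‖ → Orthonormal ℂ (Fin.snoc w ((‖v‖⁻¹ : ℂ) • v) : Fin (m + 1) → H) := by
      intro w v hw hwv hv
      constructor
      · intro i
        refine Fin.lastCases ?_ (fun i => ?_) i
        · simp [norm_smul, hv.ne']
        · simpa using hw.1 i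
      · intro i k
        refine Fin.lastCases ?_ (fun i => ?_) i
        · refine Fin.lastCases ?_ (fun k => ?_) k
          · simp
          · intro _
            simp only [Fin.snoc_last, Fin.snoc_castSucc, inner_smul_left]
            rw [inner_eq_zero_symm.mp (hwv k), mul_zero]
        · refine Fin.lastCases ?_ (fun k => ?_) k
          · intro _
            simp [inner_smul_right, hwv]
          · intro h
            simpa using hw.2 (fun h' => h (by rw [h']))
    refine ⟨_, _, snoc he hyE hypos, snoc hf hzF hzpos, fun k => ?_⟩
    refine Fin.lastCases ?_ (fun k => ?_) k
    · simp only [Fin.snoc_last, map_smul, inner_smul_left, inner_smul_right, hzTy]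
      have : (starRingEnd ℂ) ((‖z‖ : ℂ)⁻¹) * (((‖y‖ : ℂ)⁻¹) * (‖z‖ : ℂ) ^ 2)
          = ((‖z‖ / ‖y‖ : ℝ) : ℂ) := by
        rw [map_inv₀, Complex.conj_ofReal]
        push_cast
        have : (‖z‖ : ℂ) ≠ 0 := by exact_mod_cast hzpos.ne'
        field_simp
      rw [mul_left_comm, this, Complex.ofReal_re, le_div_iff₀ hypos]
      exact (mul_le_mul_of_nonneg_left hyx hc).trans hx.le
    · simpa using hef k

end SingularValues

section Transformers

set_option linter.unusedSectionVars false

variable {H : Type} [NormedAddCommGroup H] [InnerProductSpace ℂ H] [CompleteSpace H]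

/-- A linear transformer of operators which is bounded by `L` both in the operator norm and, tested
on elementary operators, in the trace norm. -/
structure IsBoundedTransformer (L : ℝ) (Ψ : (H →L[ℂ] H) →ₗ[ℂ] (H →L[ℂ] H)) : Prop where
  norm_inner_le : ∀ (X : H →L[ℂ] H) (e f : H), ‖e‖ = 1 → ‖f‖ = 1 →
    ‖inner ℂ f (Ψ X e)‖ ≤ L * ‖X‖
  norm_sum_inner_rankOne_le : ∀ (m : ℕ) (e f : Fin m → H), Orthonormal ℂ e → Orthonormal ℂ f →
    ∀ x y : H, ‖∑ k, inner ℂ (f k) (Ψ (InnerProductSpace.rankOne ℂ x y) (e k))‖ ≤ L * (‖x‖ * ‖y‖)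

lemma IsBoundedTransformer.add {L₁ L₂ : ℝ} {Ψ₁ Ψ₂ : (H →L[ℂ] H) →ₗ[ℂ] (H →L[ℂ] H)}
    (h₁ : IsBoundedTransformer L₁ Ψ₁) (h₂ : IsBoundedTransformer L₂ Ψ₂) :
    IsBoundedTransformer (L₁ + L₂) (Ψ₁ + Ψ₂) where
  norm_inner_le X e f he hf := by
    rw [LinearMap.add_apply, _root_.add_apply, inner_add_right, add_mul]
    exact (norm_add_le _ _).trans
      (add_le_add (h₁.norm_inner_le X e f he hf) (h₂.norm_inner_le X e f he hf))
  norm_sum_inner_rankOne_le m e f he hf x y := by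
    simp only [LinearMap.add_apply, _root_.add_apply, inner_add_right, add_mul,
      Finset.sum_add_distrib]
    exact (norm_add_le _ _).trans (add_le_add (h₁.norm_sum_inner_rankOne_le m e f he hf x y)
      (h₂.norm_sum_inner_rankOne_le m e f he hf x y))

lemma IsBoundedTransformer.norm_sum_inner_le {L : ℝ} {Ψ : (H →L[ℂ] H) →ₗ[ℂ] (H →L[ℂ] H)}
    (h : IsBoundedTransformer L Ψ) {m : ℕ} {e f : Fin m → H} (he : Orthonormal ℂ e)
    (hf : Orthonormal ℂ f) (X : H →L[ℂ] H) :
    ‖∑ k, inner ℂ (f k) (Ψ X (e k))‖ ≤ m * (L * ‖X‖) := by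
  refine (norm_sum_le _ _).trans ((Finset.sum_le_sum fun k _ =>
    h.norm_inner_le X (e k) (f k) (he.1 k) (hf.1 k)).trans ?_)
  simp

lemma IsBoundedTransformer.norm_sum_inner_le_of_rank_le {L : ℝ} (hL : 0 ≤ L)
    {Ψ : (H →L[ℂ] H) →ₗ[ℂ] (H →L[ℂ] H)}
    (h : IsBoundedTransformer L Ψ) {m : ℕ} {e f : Fin m → H} (he : Orthonormal ℂ e)
    (hf : Orthonormal ℂ f) {R : H →L[ℂ] H} {r : ℕ}
    (hR : LinearMap.rank (R : H →ₗ[ℂ] H) ≤ (r : Cardinal)) :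
    ‖∑ k, inner ℂ (f k) (Ψ R (e k))‖ ≤ r * (L * ‖R‖) := by
  obtain ⟨n, x, y, hn, hx, hy, hRxy⟩ := exists_eq_sum_rankOne hR
  have hsum : ∑ k, inner ℂ (f k) (Ψ R (e k)) = ∑ i, ∑ k, inner ℂ (f k)
      (Ψ (InnerProductSpace.rankOne ℂ (x i) (y i)) (e k)) := by
    conv_lhs => rw [hRxy]
    simp only [map_sum, _root_.sum_apply, inner_sum]
    exact Finset.sum_comm
  rw [hsum]
  calc _ ≤ ∑ i : Fin n, L * ‖R‖ := by
        refine (norm_sum_le _ _).trans (Finset.sum_le_sum fun i _ => ?_)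
        refine (h.norm_sum_inner_rankOne_le m e f he hf (x i) (y i)).trans ?_
        refine mul_le_mul_of_nonneg_left ?_ hL
        calc ‖x i‖ * ‖y i‖ ≤ 1 * ‖R‖ :=
              mul_le_mul (hx i) (hy i) (norm_nonneg _) zero_le_one
          _ = ‖R‖ := one_mul _
    _ = n * (L * ‖R‖) := by simp
    _ ≤ r * (L * ‖R‖) := by gcongr

lemma IsBoundedTransformer.sVal_add_le_of_pos {L : ℝ} (hL : 0 ≤ L)
    {Ψ : (H →L[ℂ] H) →ₗ[ℂ] (H →L[ℂ] H)}
    (h : IsBoundedTransformer L Ψ) (D E : H →L[ℂ] H) (N : ℕ) {ε : ℝ} (hε : 0 < ε) :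
    sVal (Ψ D + E) (2 * (2 ^ N - 1)) ≤
      6 * L * (∑ n ∈ Finset.range (N + 1), 2 ^ n * (sVal D (2 ^ n - 1) + ε)) / 2 ^ N + ‖E‖ := by
  set σ : ℕ → ℝ := fun n => sVal D (2 ^ n - 1) + ε with hσ
  have hσpos : ∀ n, 0 ≤ σ n := fun n => add_nonneg (sVal_nonneg _ _) hε.le
  have hσanti : ∀ n, σ (n + 1) ≤ σ n := fun n => by
    have : 2 ^ n - 1 ≤ 2 ^ (n + 1) - 1 := Nat.sub_le_sub_right
      (Nat.pow_le_pow_right (by norm_num) n.le_succ) 1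
    exact add_le_add_left (sVal_antitone D this) ε
  have hex : ∀ n, ∃ R : H →L[ℂ] H,
      LinearMap.rank (R : H →ₗ[ℂ] H) ≤ ((2 ^ n - 1 : ℕ) : Cardinal) ∧ ‖D - R‖ < σ n := fun n =>
    exists_rank_le_norm_sub_lt D _ (lt_add_of_pos_right _ hε)
  choose R hRrank hRnorm using hex
  have hB : 0 ≤ 6 * L * (∑ n ∈ Finset.range (N + 1), 2 ^ n * σ n) / 2 ^ N + ‖E‖ := by
    have : 0 ≤ ∑ n ∈ Finset.range (N + 1), 2 ^ n * σ n :=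
      Finset.sum_nonneg fun n _ => mul_nonneg (by positivity) (hσpos n)
    positivity
  refine le_of_forall_lt_imp_le_of_dense fun c hc => ?_
  rcases lt_or_ge c 0 with hc0 | hc0
  · exact hc0.le.trans hB
  have hpow : 2 ^ N - 1 + 1 = 2 ^ N := Nat.sub_add_cancel Nat.one_le_two_pow
  obtain ⟨e, f, he, hf, hef⟩ := exists_orthonormal_lt_inner (Ψ D + E) hc0 (2 ^ N - 1) hc (2 ^ N)
    hpow.ge
  have hRsum : ∀ M, ‖∑ k, inner ℂ (f k) (Ψ (R M) (e k))‖ ≤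
      6 * L * ∑ n ∈ Finset.range M, 2 ^ n * σ n := by
    intro M
    induction M with
    | zero =>
      refine (h.norm_sum_inner_le_of_rank_le hL he hf (hRrank 0)).trans ?_
      simp
    | succ M ih =>
      have hsplit : ∑ k, inner ℂ (f k) (Ψ (R (M + 1)) (e k)) =
          ∑ k, inner ℂ (f k) (Ψ (R (M + 1) - R M) (e k)) +
            ∑ k, inner ℂ (f k) (Ψ (R M) (e k)) := by
        simp [map_sub, Finset.sum_sub_distrib]
      have hrank : LinearMap.rank ((R (M + 1) - R M : H →L[ℂ] H) : H →ₗ[ℂ] H) ≤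
          ((3 * 2 ^ M : ℕ) : Cardinal) := by
        refine (rank_sub_le_nat (hRrank (M + 1)) (hRrank M)).trans ?_
        exact_mod_cast (by rw [pow_succ]; omega)
      have hn : ‖R (M + 1) - R M‖ ≤ 2 * σ M := by
        have : R (M + 1) - R M = (D - R M) - (D - R (M + 1)) := by abel
        rw [this]
        refine (norm_sub_le _ _).trans ?_
        linarith [hRnorm M, hRnorm (M + 1), hσanti M]
      have h1 := h.norm_sum_inner_le_of_rank_le hL he hf hrank
      have h2 : ((3 * 2 ^ M : ℕ) : ℝ) * (L * ‖R (M + 1) - R M‖) ≤ 6 * L * (2 ^ M * σ M) := by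
        push_cast
        calc (3 * 2 ^ M : ℝ) * (L * ‖R (M + 1) - R M‖) ≤ 3 * 2 ^ M * (L * (2 * σ M)) := by gcongr
          _ = 6 * L * (2 ^ M * σ M) := by ring
      rw [hsplit, Finset.sum_range_succ, mul_add]
      refine (norm_add_le _ _).trans ?_
      linarith
  have hD : ‖∑ k, inner ℂ (f k) (Ψ D (e k))‖ ≤
      6 * L * ∑ n ∈ Finset.range (N + 1), 2 ^ n * σ n := by
    have hsplit : ∑ k, inner ℂ (f k) (Ψ D (e k)) =
        ∑ k, inner ℂ (f k) (Ψ (D - R N) (e k)) + ∑ k, inner ℂ (f k) (Ψ (R N) (e k)) := by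
      simp [map_sub, Finset.sum_sub_distrib]
    have h1 := h.norm_sum_inner_le he hf (D - R N)
    have h2 : ((2 ^ N : ℕ) : ℝ) * (L * ‖D - R N‖) ≤ 6 * L * (2 ^ N * σ N) := by
      push_cast
      calc (2 ^ N : ℝ) * (L * ‖D - R N‖) ≤ 2 ^ N * (L * σ N) := by
            have := (hRnorm N).le
            gcongr
        _ ≤ 6 * (2 ^ N * (L * σ N)) := by
            have : 0 ≤ 2 ^ N * (L * σ N) := by have := hσpos N; positivity
            linarith
        _ = _ := by ring
    rw [hsplit, Finset.sum_range_succ, mul_add]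
    refine (norm_add_le _ _).trans ?_
    linarith [hRsum N]
  have hE : ‖∑ k, inner ℂ (f k) (E (e k))‖ ≤ 2 ^ N * ‖E‖ := by
    refine (norm_sum_le _ _).trans ((Finset.sum_le_sum (g := fun _ => ‖E‖) fun k _ => ?_).trans ?_)
    · refine (norm_inner_le_norm _ _).trans ?_
      have := E.le_opNorm (e k)
      rwa [hf.1 k, one_mul, ← mul_one ‖E‖, ← he.1 k]
    · simp
  have hlow : 2 ^ N * c ≤ ‖∑ k, inner ℂ (f k) ((Ψ D + E) (e k))‖ := by
    refine le_trans ?_ (Complex.re_le_norm _)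
    rw [Complex.re_sum]
    refine le_trans ?_ (Finset.sum_le_sum fun k _ => hef k)
    simp
  have hup : ‖∑ k, inner ℂ (f k) ((Ψ D + E) (e k))‖ ≤
      6 * L * (∑ n ∈ Finset.range (N + 1), 2 ^ n * σ n) + 2 ^ N * ‖E‖ := by
    simp only [_root_.add_apply, inner_add_right, Finset.sum_add_distrib]
    exact (norm_add_le _ _).trans (add_le_add hD hE)
  have hN : (0 : ℝ) < 2 ^ N := by positivity
  rw [← sub_le_iff_le_add, le_div_iff₀ hN]
  linarith

/-- Interpolation estimate for the dyadic singular values of a bounded transformer. -/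
lemma IsBoundedTransformer.sVal_add_le {L : ℝ} (hL : 0 ≤ L)
    {Ψ : (H →L[ℂ] H) →ₗ[ℂ] (H →L[ℂ] H)}
    (h : IsBoundedTransformer L Ψ) (D E : H →L[ℂ] H) (N : ℕ) :
    sVal (Ψ D + E) (2 * (2 ^ N - 1)) ≤
      6 * L * ((∑ n ∈ Finset.range (N + 1), 2 ^ n * sVal D (2 ^ n - 1)) / 2 ^ N) + ‖E‖ := by
  have hcont : Continuous fun ε : ℝ => 6 * L *
      (∑ n ∈ Finset.range (N + 1), 2 ^ n * (sVal D (2 ^ n - 1) + ε)) / 2 ^ N + ‖E‖ := by fun_prop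
  have hlim := (hcont.tendsto 0).mono_left (nhdsWithin_le_nhds (s := Set.Ioi 0))
  have := ge_of_tendsto hlim (Filter.eventually_of_mem self_mem_nhdsWithin
    fun ε hε => h.sVal_add_le_of_pos hL D E N hε)
  simpa [mul_div_assoc] using this

end Transformers

section FunctionalCalculus

open MeasureTheory

variable {H : Type} [NormedAddCommGroup H] [InnerProductSpace ℂ H] [CompleteSpace H]

lemma continuousOn_comp_re {φ : ℝ → ℂ} (hφ : Continuous φ) (s : Set ℂ) :
    ContinuousOn (fun z : ℂ => φ z.re) s :=
  (hφ.comp Complex.continuous_re).continuousOn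

lemma abs_re_le_norm_of_mem_spectrum {A : H →L[ℂ] H} {z : ℂ} (hz : z ∈ spectrum ℂ A) :
    |z.re| ≤ ‖A‖ := by
  refine (Complex.abs_re_le_norm z).trans ((spectrum.norm_le_norm_mul_of_mem hz).trans ?_)
  exact mul_le_of_le_one_right (norm_nonneg _) ContinuousLinearMap.norm_id_le

lemma opFun_congr {φ ψ : ℝ → ℂ} {A : H →L[ℂ] H} (h : ∀ x, |x| ≤ ‖A‖ → φ x = ψ x) :
    opFun φ A = opFun ψ A :=
  cfc_congr fun _ hz => h _ (abs_re_le_norm_of_mem_spectrum hz)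

lemma opFun_add {φ ψ : ℝ → ℂ} (hφ : Continuous φ) (hψ : Continuous ψ) (A : H →L[ℂ] H) :
    opFun (fun x => φ x + ψ x) A = opFun φ A + opFun ψ A :=
  cfc_add A _ _ (continuousOn_comp_re hφ _) (continuousOn_comp_re hψ _)

lemma opFun_sub {φ ψ : ℝ → ℂ} (hφ : Continuous φ) (hψ : Continuous ψ) (A : H →L[ℂ] H) :
    opFun (fun x => φ x - ψ x) A = opFun φ A - opFun ψ A :=
  cfc_sub _ _ A (continuousOn_comp_re hφ _) (continuousOn_comp_re hψ _)

lemma opFun_mul {φ ψ : ℝ → ℂ} (hφ : Continuous φ) (hψ : Continuous ψ) (A : H →L[ℂ] H) :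
    opFun (fun x => φ x * ψ x) A = opFun φ A * opFun ψ A :=
  cfc_mul _ _ A (continuousOn_comp_re hφ _) (continuousOn_comp_re hψ _)

lemma opFun_const_mul {φ : ℝ → ℂ} (hφ : Continuous φ) (c : ℂ) (A : H →L[ℂ] H) :
    opFun (fun x => c * φ x) A = c • opFun φ A :=
  cfc_const_mul c _ A (continuousOn_comp_re hφ _)

lemma opFun_const (c : ℂ) {A : H →L[ℂ] H} (hA : IsSelfAdjoint A) :
    opFun (fun _ => c) A = c • (1 : H →L[ℂ] H) := by
  have := hA.isStarNormal
  rw [opFun, cfc_const c A, Algebra.algebraMap_eq_smul_one]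

lemma opFun_ofReal {A : H →L[ℂ] H} (hA : IsSelfAdjoint A) :
    opFun (fun x => (x : ℂ)) A = A := by
  have := hA.isStarNormal
  conv_rhs => rw [← cfc_id' ℂ A]
  exact cfc_congr fun z hz => (hA.mem_spectrum_eq_re hz).symm

lemma adjoint_opFun (φ : ℝ → ℂ) (A : H →L[ℂ] H) :
    ContinuousLinearMap.adjoint (opFun φ A) = opFun (fun x => (starRingEnd ℂ) (φ x)) A :=
  (cfc_star _ A).symm

lemma norm_opFun_le {φ : ℝ → ℂ} {M : ℝ} (hM : 0 ≤ M) (h : ∀ x, ‖φ x‖ ≤ M) (A : H →L[ℂ] H) :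
    ‖opFun φ A‖ ≤ M :=
  norm_cfc_le hM fun _ _ => h _

lemma integrable_opFun {F : ℝ → ℝ → ℂ} (hF : Continuous (Function.uncurry F)) {bound : ℝ → ℝ}
    {A : H →L[ℂ] H} (hA : IsSelfAdjoint A) (hb : ∀ s x, |x| ≤ ‖A‖ → ‖F s x‖ ≤ bound s)
    (hbi : Integrable bound) : Integrable fun s => opFun (F s) A := by
  have := hA.isStarNormal
  refine integrable_cfc (fun (s : ℝ) (z : ℂ) => F s z.re) bound A ?_ ?_ hbi.2
  · exact (hF.comp (continuous_fst.prodMk (Complex.continuous_re.comp continuous_snd))).continuousOn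
  · exact Filter.Eventually.of_forall fun s z hz => hb s _ (abs_re_le_norm_of_mem_spectrum hz)

lemma opFun_integral {F : ℝ → ℝ → ℂ} (hF : Continuous (Function.uncurry F)) {bound : ℝ → ℝ}
    {A : H →L[ℂ] H} (hA : IsSelfAdjoint A) (hb : ∀ s x, |x| ≤ ‖A‖ → ‖F s x‖ ≤ bound s)
    (hbi : Integrable bound) : opFun (fun x => ∫ s, F s x) A = ∫ s, opFun (F s) A := by
  have := hA.isStarNormal
  refine cfc_integral (fun (s : ℝ) (z : ℂ) => F s z.re) bound A ?_ ?_ hbi.2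
  · exact (hF.comp (continuous_fst.prodMk (Complex.continuous_re.comp continuous_snd))).continuousOn
  · exact Filter.Eventually.of_forall fun s z hz => hb s _ (abs_re_le_norm_of_mem_spectrum hz)

end FunctionalCalculus

section Kernels

open MeasureTheory

/-- The Cauchy kernel with pole at `s + t i`. -/
def cauchyKer (t s x : ℝ) : ℂ := ((x : ℂ) - s - t * Complex.I)⁻¹

/-- The kernel `1 / ((x - s)² + t²)`. -/
def poissonKer (t s x : ℝ) : ℝ := ((x - s) ^ 2 + t ^ 2)⁻¹

lemma poissonKer_denom_pos {t : ℝ} (ht : t ≠ 0) (s x : ℝ) : 0 < (x - s) ^ 2 + t ^ 2 := by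
  positivity

lemma poissonKer_nonneg (t s x : ℝ) : 0 ≤ poissonKer t s x := by
  unfold poissonKer; positivity

lemma cauchyKer_denom_ne {t : ℝ} (ht : t ≠ 0) (s x : ℝ) : (x : ℂ) - s - t * Complex.I ≠ 0 := by
  intro h
  have := congrArg Complex.im h
  simp at this
  exact ht this

lemma conj_cauchyKer (t s x : ℝ) : (starRingEnd ℂ) (cauchyKer t s x) = cauchyKer (-t) s x := by
  simp [cauchyKer]

lemma cauchyKer_neg_mul (t s x : ℝ) :
    cauchyKer (-t) s x * cauchyKer t s x = (poissonKer t s x : ℂ) := by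
  rw [cauchyKer, cauchyKer, poissonKer, ← mul_inv]
  push_cast
  congr 1
  ring_nf
  rw [Complex.I_sq]
  ring

lemma cauchyKer_sub_neg {t : ℝ} (ht : t ≠ 0) (s x : ℝ) :
    cauchyKer t s x - cauchyKer (-t) s x = 2 * t * Complex.I * (poissonKer t s x : ℂ) := by
  rw [← cauchyKer_neg_mul]
  have h1 := cauchyKer_denom_ne ht s x
  have h2 := cauchyKer_denom_ne (neg_ne_zero.mpr ht) s x
  rw [cauchyKer, cauchyKer, inv_sub_inv h1 h2, div_eq_mul_inv, mul_inv]
  push_cast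
  ring

lemma norm_cauchyKer_le {t : ℝ} (ht : t ≠ 0) (s x : ℝ) : ‖cauchyKer t s x‖ ≤ |t|⁻¹ := by
  rw [cauchyKer, norm_inv]
  refine inv_anti₀ (abs_pos.mpr ht) ?_
  refine le_trans ?_ (Complex.abs_im_le_norm _)
  simp

lemma continuous_uncurry_cauchyKer {t : ℝ} (ht : t ≠ 0) :
    Continuous (Function.uncurry (cauchyKer t)) := by
  unfold cauchyKer Function.uncurry
  refine Continuous.inv₀ (by fun_prop) fun a => cauchyKer_denom_ne ht _ _

lemma continuous_cauchyKer {t : ℝ} (ht : t ≠ 0) (s : ℝ) : Continuous (cauchyKer t s) :=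
  (continuous_uncurry_cauchyKer ht).comp (Continuous.prodMk_right s)

lemma continuous_uncurry_poissonKer {t : ℝ} (ht : t ≠ 0) :
    Continuous (Function.uncurry (poissonKer t)) := by
  unfold poissonKer Function.uncurry
  exact Continuous.inv₀ (by fun_prop) fun a => (poissonKer_denom_pos ht _ _).ne'

lemma poissonKer_le {t : ℝ} (ht : t ≠ 0) {r x : ℝ} (hx : |x| ≤ r) (s : ℝ) :
    poissonKer t s x ≤ (2 + (1 + 2 * r ^ 2) / t ^ 2) * (1 + s ^ 2)⁻¹ := by
  have hx2 : x ^ 2 ≤ r ^ 2 := sq_le_sq' (by linarith [neg_abs_le x]) ((le_abs_self x).trans hx)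
  rw [poissonKer, ← div_eq_mul_inv, inv_le_comm₀ (poissonKer_denom_pos ht s x) (by positivity),
    inv_div, div_le_iff₀ (by positivity)]
  have ht2 : 0 < t ^ 2 := by positivity
  have h1 : (1 + 2 * r ^ 2) / t ^ 2 * t ^ 2 = 1 + 2 * r ^ 2 := by field_simp
  have h2 : 0 ≤ (x - s) ^ 2 * ((1 + 2 * r ^ 2) / t ^ 2) := by positivity
  nlinarith [sq_nonneg (2 * x - s)]

lemma integrable_poissonKer_bound (t r : ℝ) :
    Integrable fun s : ℝ => (2 + (1 + 2 * r ^ 2) / t ^ 2) * (1 + s ^ 2)⁻¹ :=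
  integrable_inv_one_add_sq.const_mul _

lemma poissonKer_eq_scale {t : ℝ} (ht : t ≠ 0) (s x : ℝ) :
    poissonKer t s x = (t ^ 2)⁻¹ * (1 + ((x - s) / t) ^ 2)⁻¹ := by
  rw [poissonKer, ← mul_inv]
  congr 1
  field_simp
  ring

lemma integral_poissonKer_mul {t : ℝ} (ht : 0 < t) (h : ℝ → ℂ) (x : ℝ) :
    ∫ s, h s * (poissonKer t s x : ℂ) =
      (t : ℂ)⁻¹ * ∫ u : ℝ, h (x - t * u) * (((1 + u ^ 2)⁻¹ : ℝ) : ℂ) := by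
  set g : ℝ → ℂ := fun u => h (x - t * u) * (((1 + u ^ 2)⁻¹ : ℝ) : ℂ) with hg
  have h1 : (fun s => h s * (poissonKer t s x : ℂ)) =
      fun s => ((t ^ 2)⁻¹ : ℂ) * (fun y => g (y / t)) (x - s) := by
    funext s
    rw [poissonKer_eq_scale ht.ne']
    have : x - t * ((x - s) / t) = s := by field_simp; ring
    simp only [hg, this]
    push_cast
    ring
  rw [h1, integral_const_mul, integral_sub_left_eq_self (fun y => g (y / t)) volume x,
    Measure.integral_comp_div g t, abs_of_pos ht, Complex.real_smul, ← mul_assoc]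
  congr 1
  have : (t : ℂ) ≠ 0 := by exact_mod_cast ht.ne'
  field_simp

lemma integral_poissonKer {t : ℝ} (ht : t ≠ 0) (x : ℝ) :
    ∫ s, (poissonKer t s x : ℂ) = ((Real.pi / |t| : ℝ) : ℂ) := by
  have h := integral_poissonKer_mul (abs_pos.mpr ht) (fun _ => 1) x
  simp only [one_mul, integral_complex_ofReal] at h
  rw [integral_univ_inv_one_add_sq] at h
  have h2 : (fun s => poissonKer |t| s x) = fun s => poissonKer t s x := by
    funext s; simp [poissonKer]
  rw [h2] at h
  rw [integral_complex_ofReal, h]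
  push_cast
  ring

end Kernels

section Resolvents

set_option linter.unusedSectionVars false

open MeasureTheory

variable {H : Type} [NormedAddCommGroup H] [InnerProductSpace ℂ H] [CompleteSpace H]

/-- The resolvent `(A - s - t i)⁻¹`. -/
def cauchyOp (A : H →L[ℂ] H) (t s : ℝ) : H →L[ℂ] H := opFun (cauchyKer t s) A

lemma adjoint_cauchyOp (A : H →L[ℂ] H) (t s : ℝ) :
    ContinuousLinearMap.adjoint (cauchyOp A t s) = cauchyOp A (-t) s := by
  rw [cauchyOp, adjoint_opFun, cauchyOp]
  congr 1
  funext x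
  exact conj_cauchyKer t s x

lemma cauchyOp_neg_mul {t : ℝ} (ht : t ≠ 0) (A : H →L[ℂ] H) (s : ℝ) :
    cauchyOp A (-t) s * cauchyOp A t s = opFun (fun x => (poissonKer t s x : ℂ)) A := by
  rw [cauchyOp, cauchyOp, ← opFun_mul (continuous_cauchyKer (neg_ne_zero.mpr ht) s)
    (continuous_cauchyKer ht s)]
  congr 1
  funext x
  exact cauchyKer_neg_mul t s x

lemma continuous_cauchyOp {t : ℝ} (ht : t ≠ 0) (A : H →L[ℂ] H) : Continuous (cauchyOp A t) := by
  have h : LipschitzWith (Real.toNNReal (|t|⁻¹ * |t|⁻¹)) (cauchyOp A t) := by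
    refine LipschitzWith.of_dist_le_mul fun s s' => ?_
    rw [dist_eq_norm, cauchyOp, cauchyOp, ← opFun_sub (continuous_cauchyKer ht s)
      (continuous_cauchyKer ht s'), Real.coe_toNNReal _ (by positivity)]
    refine norm_opFun_le (by positivity) (fun x => ?_) A
    have h1 := cauchyKer_denom_ne ht s x
    have h2 := cauchyKer_denom_ne ht s' x
    have : cauchyKer t s x - cauchyKer t s' x =
        cauchyKer t s x * cauchyKer t s' x * ((s - s' : ℝ) : ℂ) := by
      rw [cauchyKer, cauchyKer, inv_sub_inv h1 h2, div_eq_mul_inv, mul_inv]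
      push_cast
      ring
    rw [this, norm_mul, norm_mul, Complex.norm_real, Real.dist_eq, Real.norm_eq_abs]
    gcongr <;> exact norm_cauchyKer_le ht _ _
  exact h.continuous

lemma cauchyOp_mul_sub {t : ℝ} (ht : t ≠ 0) {A B : H →L[ℂ] H} (hA : IsSelfAdjoint A)
    (hB : IsSelfAdjoint B) (Q : H →L[ℂ] H) (s : ℝ) :
    cauchyOp A t s * Q - Q * cauchyOp B t s =
      -(cauchyOp A t s * (A * Q - Q * B) * cauchyOp B t s) := by
  set w : ℂ := s + t * Complex.I with hw
  have hcont : Continuous fun x : ℝ => (x : ℂ) - w := by fun_prop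
  have hop : ∀ {C : H →L[ℂ] H}, IsSelfAdjoint C →
      opFun (fun x : ℝ => (x : ℂ) - w) C = C - w • (1 : H →L[ℂ] H) := fun hC => by
    rw [opFun_sub Complex.continuous_ofReal continuous_const, opFun_ofReal hC, opFun_const w hC]
  have hA1 : cauchyOp A t s * (A - w • (1 : H →L[ℂ] H)) = 1 := by
    rw [← hop hA, cauchyOp, ← opFun_mul (continuous_cauchyKer ht s) hcont]
    rw [show (fun x => cauchyKer t s x * ((x : ℂ) - w)) = fun _ => (1 : ℂ) from ?_]
    · rw [opFun_const 1 hA, one_smul]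
    · funext x
      rw [cauchyKer, hw, ← sub_sub]
      exact inv_mul_cancel₀ (cauchyKer_denom_ne ht s x)
  have hB1 : (B - w • (1 : H →L[ℂ] H)) * cauchyOp B t s = 1 := by
    rw [← hop hB, cauchyOp, ← opFun_mul hcont (continuous_cauchyKer ht s)]
    rw [show (fun x : ℝ => ((x : ℂ) - w) * cauchyKer t s x) = fun _ => (1 : ℂ) from ?_]
    · rw [opFun_const 1 hB, one_smul]
    · funext x
      rw [cauchyKer, hw, ← sub_sub]
      exact mul_inv_cancel₀ (cauchyKer_denom_ne ht s x)
  have hD : A * Q - Q * B = (A - w • (1 : H →L[ℂ] H)) * Q - Q * (B - w • (1 : H →L[ℂ] H)) := by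
    simp only [sub_mul, mul_sub, smul_mul_assoc, mul_smul_comm, one_mul, mul_one]
    abel
  rw [hD, mul_sub, sub_mul, ← mul_assoc, hA1, one_mul, mul_assoc, mul_assoc, hB1, mul_one,
    neg_sub]

lemma norm_cauchyOp_apply_sq {t : ℝ} (ht : t ≠ 0) (A : H →L[ℂ] H) (s : ℝ) (x : H) :
    ((‖cauchyOp A t s x‖ ^ 2 : ℝ) : ℂ) =
      inner ℂ x (opFun (fun y => (poissonKer t s y : ℂ)) A x) := by
  rw [← cauchyOp_neg_mul ht, ← adjoint_cauchyOp, mul_apply_eq_comp,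
    ContinuousLinearMap.adjoint_inner_right, inner_self_eq_norm_sq_to_K]
  push_cast
  rfl

lemma continuous_uncurry_ofReal_poissonKer {t : ℝ} (ht : t ≠ 0) :
    Continuous (Function.uncurry fun s x => (poissonKer t s x : ℂ)) :=
  Complex.continuous_ofReal.comp (continuous_uncurry_poissonKer ht)

lemma norm_ofReal_poissonKer_le {t : ℝ} (ht : t ≠ 0) {r : ℝ} (s x : ℝ) (hx : |x| ≤ r) :
    ‖(poissonKer t s x : ℂ)‖ ≤ (2 + (1 + 2 * r ^ 2) / t ^ 2) * (1 + s ^ 2)⁻¹ := by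
  rw [Complex.norm_real, Real.norm_of_nonneg (poissonKer_nonneg _ _ _)]
  exact poissonKer_le ht hx s

lemma integrable_opFun_poissonKer {t : ℝ} (ht : t ≠ 0) {A : H →L[ℂ] H} (hA : IsSelfAdjoint A) :
    Integrable fun s => opFun (fun x => (poissonKer t s x : ℂ)) A :=
  integrable_opFun (continuous_uncurry_ofReal_poissonKer ht) hA
    (fun s x hx => norm_ofReal_poissonKer_le ht s x hx) (integrable_poissonKer_bound t ‖A‖)

lemma norm_cauchyOp_sq {t : ℝ} (ht : t ≠ 0) (A : H →L[ℂ] H) (s : ℝ) :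
    ‖cauchyOp A t s‖ ^ 2 = ‖opFun (fun x => (poissonKer t s x : ℂ)) A‖ := by
  rw [← cauchyOp_neg_mul ht, ← adjoint_cauchyOp, sq]
  exact (CStarRing.norm_star_mul_self (x := cauchyOp A t s)).symm

lemma integrable_norm_cauchyOp_sq {t : ℝ} (ht : t ≠ 0) {A : H →L[ℂ] H} (hA : IsSelfAdjoint A) :
    Integrable fun s => ‖cauchyOp A t s‖ ^ 2 := by
  simp only [norm_cauchyOp_sq ht]
  exact (integrable_opFun_poissonKer ht hA).norm

/-- The functional `X ↦ ⟪f, X e⟫`. -/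
def matrixCoeff (f e : H) : (H →L[ℂ] H) →L[ℂ] ℂ :=
  (innerSL ℂ f) ∘L (ContinuousLinearMap.apply ℂ H e)

@[simp] lemma matrixCoeff_apply (f e : H) (X : H →L[ℂ] H) :
    matrixCoeff f e X = inner ℂ f (X e) := rfl

lemma integrable_norm_cauchyOp_apply_sq {t : ℝ} (ht : t ≠ 0) {A : H →L[ℂ] H}
    (hA : IsSelfAdjoint A) (x : H) : Integrable fun s => ‖cauchyOp A t s x‖ ^ 2 := by
  have h := ((matrixCoeff x x).integrable_comp (integrable_opFun_poissonKer ht hA)).re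
  refine h.congr (Filter.Eventually.of_forall fun s => ?_)
  simp only [matrixCoeff_apply, ← norm_cauchyOp_apply_sq ht A s x]
  exact Complex.ofReal_re _

lemma integral_norm_cauchyOp_apply_sq {t : ℝ} (ht : t ≠ 0) {A : H →L[ℂ] H}
    (hA : IsSelfAdjoint A) (x : H) :
    ∫ s, ‖cauchyOp A t s x‖ ^ 2 = Real.pi / |t| * ‖x‖ ^ 2 := by
  have h : ((∫ s, ‖cauchyOp A t s x‖ ^ 2 : ℝ) : ℂ) = ((Real.pi / |t| * ‖x‖ ^ 2 : ℝ) : ℂ) := by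
    rw [← integral_complex_ofReal]
    simp only [norm_cauchyOp_apply_sq ht A _ x, ← matrixCoeff_apply]
    rw [(matrixCoeff x x).integral_comp_comm (integrable_opFun_poissonKer ht hA),
      ← opFun_integral (continuous_uncurry_ofReal_poissonKer ht) hA
        (fun s x hx => norm_ofReal_poissonKer_le ht s x hx) (integrable_poissonKer_bound t ‖A‖)]
    simp only [integral_poissonKer ht]
    rw [opFun_const _ hA, matrixCoeff_apply, _root_.smul_apply,
      one_apply_eq_self, inner_smul_right, inner_self_eq_norm_sq_to_K]
    push_cast
    rfl
  exact_mod_cast h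

lemma integrable_norm_cauchyOp_mul {t u : ℝ} (ht : t ≠ 0) (hu : u ≠ 0) {A B : H →L[ℂ] H}
    (hA : IsSelfAdjoint A) (hB : IsSelfAdjoint B) (x y : H) :
    Integrable fun s => ‖cauchyOp A t s x‖ * ‖cauchyOp B u s y‖ := by
  refine ((integrable_norm_cauchyOp_apply_sq ht hA x).add
    (integrable_norm_cauchyOp_apply_sq hu hB y)).mono' ?_ (Filter.Eventually.of_forall fun s => ?_)
  · have h1 := continuous_cauchyOp ht A
    have h2 := continuous_cauchyOp hu B
    exact Continuous.aestronglyMeasurable (by fun_prop)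
  · rw [Real.norm_of_nonneg (by positivity)]
    simp only [Pi.add_apply]
    nlinarith [sq_nonneg (‖cauchyOp A t s x‖ - ‖cauchyOp B u s y‖), sq_nonneg ‖cauchyOp A t s x‖,
      sq_nonneg ‖cauchyOp B u s y‖]

lemma integral_norm_cauchyOp_mul_le {t u : ℝ} (ht : t ≠ 0) (hu : |u| = |t|) {A B : H →L[ℂ] H}
    (hA : IsSelfAdjoint A) (hB : IsSelfAdjoint B) (x y : H) :
    ∫ s, ‖cauchyOp A t s x‖ * ‖cauchyOp B u s y‖ ≤ Real.pi / |t| * (‖x‖ * ‖y‖) := by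
  have hu0 : u ≠ 0 := abs_pos.mp (hu ▸ abs_pos.mpr ht)
  rcases eq_or_ne x 0 with rfl | hx
  · simp
  rcases eq_or_ne y 0 with rfl | hy
  · simp
  have hx' : 0 < ‖x‖ := norm_pos_iff.mpr hx
  have hy' : 0 < ‖y‖ := norm_pos_iff.mpr hy
  have hi1 := (integrable_norm_cauchyOp_apply_sq ht hA x).const_mul (‖y‖ / ‖x‖ / 2)
  have hi2 := (integrable_norm_cauchyOp_apply_sq hu0 hB y).const_mul (‖x‖ / ‖y‖ / 2)
  calc ∫ s, ‖cauchyOp A t s x‖ * ‖cauchyOp B u s y‖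
      ≤ ∫ s, (‖y‖ / ‖x‖ / 2 * ‖cauchyOp A t s x‖ ^ 2 + ‖x‖ / ‖y‖ / 2 * ‖cauchyOp B u s y‖ ^ 2) := by
        refine integral_mono (integrable_norm_cauchyOp_mul ht hu0 hA hB x y) (hi1.add hi2)
          fun s => ?_
        set a := ‖cauchyOp A t s x‖
        set b := ‖cauchyOp B u s y‖
        have : ‖y‖ / ‖x‖ / 2 * a ^ 2 + ‖x‖ / ‖y‖ / 2 * b ^ 2 - a * b =
            (‖y‖ * a - ‖x‖ * b) ^ 2 / (2 * ‖x‖ * ‖y‖) := by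
          field_simp
          ring
        have h2 : 0 ≤ (‖y‖ * a - ‖x‖ * b) ^ 2 / (2 * ‖x‖ * ‖y‖) := by positivity
        change a * b ≤ _
        linarith
    _ = Real.pi / |t| * (‖x‖ * ‖y‖) := by
        rw [integral_add hi1 hi2, integral_const_mul, integral_const_mul,
          integral_norm_cauchyOp_apply_sq ht hA, integral_norm_cauchyOp_apply_sq hu0 hB, hu]
        field_simp
        ring

end Resolvents

section PoissonTransformer

set_option linter.unusedSectionVars false

open MeasureTheory

variable {H : Type} [NormedAddCommGroup H] [InnerProductSpace ℂ H] [CompleteSpace H]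

lemma integrable_smul_cauchyOp {t : ℝ} (ht : t ≠ 0) {A B : H →L[ℂ] H}
    (hA : IsSelfAdjoint A) (hB : IsSelfAdjoint B) {h : ℝ → ℂ} (hh : Continuous h) {M : ℝ}
    (hM : ∀ s, ‖h s‖ ≤ M) (X : H →L[ℂ] H) :
    Integrable fun s => h s • (cauchyOp A t s * X * cauchyOp B t s) := by
  refine (((integrable_norm_cauchyOp_sq ht hA).add
    (integrable_norm_cauchyOp_sq ht hB)).const_mul (M * ‖X‖)).mono' ?_
    (Filter.Eventually.of_forall fun s => ?_)
  · have h1 := continuous_cauchyOp ht A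
    have h2 := continuous_cauchyOp ht B
    exact Continuous.aestronglyMeasurable (by fun_prop)
  · have hM0 : 0 ≤ M := (norm_nonneg _).trans (hM s)
    simp only [Pi.add_apply]
    calc ‖h s • (cauchyOp A t s * X * cauchyOp B t s)‖
        ≤ M * (‖cauchyOp A t s‖ * ‖X‖ * ‖cauchyOp B t s‖) := by
          rw [norm_smul]
          refine mul_le_mul (hM s) ?_ (norm_nonneg _) hM0
          refine (norm_mul_le _ _).trans ?_
          gcongr
          exact norm_mul_le _ _
      _ = M * ‖X‖ * (‖cauchyOp A t s‖ * ‖cauchyOp B t s‖) := by ring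
      _ ≤ M * ‖X‖ * (‖cauchyOp A t s‖ ^ 2 + ‖cauchyOp B t s‖ ^ 2) := by
          gcongr
          nlinarith [sq_nonneg (‖cauchyOp A t s‖ - ‖cauchyOp B t s‖), sq_nonneg ‖cauchyOp A t s‖,
            sq_nonneg ‖cauchyOp B t s‖]

/-- The transformer `X ↦ ∫ h(s) (A - s - t i)⁻¹ X (B - s - t i)⁻¹ ds`. -/
def cauchyTransformer {t : ℝ} (ht : t ≠ 0) {A B : H →L[ℂ] H}
    (hA : IsSelfAdjoint A) (hB : IsSelfAdjoint B) {h : ℝ → ℂ} (hh : Continuous h) {M : ℝ}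
    (hM : ∀ s, ‖h s‖ ≤ M) : (H →L[ℂ] H) →ₗ[ℂ] (H →L[ℂ] H) where
  toFun X := ∫ s, h s • (cauchyOp A t s * X * cauchyOp B t s)
  map_add' X Y := by
    rw [← integral_add (integrable_smul_cauchyOp ht hA hB hh hM X)
      (integrable_smul_cauchyOp ht hA hB hh hM Y)]
    simp only [mul_add, add_mul, smul_add]
  map_smul' c X := by
    rw [RingHom.id_apply, ← integral_smul]
    simp only [mul_smul_comm, smul_mul_assoc, smul_comm c]

lemma norm_integral_smul_le {t u : ℝ} (ht : t ≠ 0) (hu : |u| = |t|) {A B : H →L[ℂ] H}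
    (hA : IsSelfAdjoint A) (hB : IsSelfAdjoint B) {h : ℝ → ℂ} {M : ℝ}
    (hM : ∀ s, ‖h s‖ ≤ M) {K : ℝ} (hK : 0 ≤ K) {G : ℝ → ℂ} (x y : H)
    (hG : ∀ s, ‖G s‖ ≤ K * (‖cauchyOp A t s x‖ * ‖cauchyOp B u s y‖)) :
    ‖∫ s, h s * G s‖ ≤ M * K * (Real.pi / |t| * (‖x‖ * ‖y‖)) := by
  have hM0 : 0 ≤ M := (norm_nonneg _).trans (hM 0)
  have hu0 : u ≠ 0 := abs_pos.mp (hu ▸ abs_pos.mpr ht)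
  have hi := (integrable_norm_cauchyOp_mul ht hu0 hA hB x y).const_mul (M * K)
  refine (norm_integral_le_of_norm_le hi (Filter.Eventually.of_forall fun s => ?_)).trans ?_
  · rw [norm_mul, mul_assoc]
    exact mul_le_mul (hM s) (hG s) (norm_nonneg _) hM0
  · rw [integral_const_mul]
    exact mul_le_mul_of_nonneg_left (integral_norm_cauchyOp_mul_le ht hu hA hB x y)
      (mul_nonneg hM0 hK)

lemma sum_norm_inner_mul_le {m : ℕ} {e f : Fin m → H} (he : Orthonormal ℂ e)
    (hf : Orthonormal ℂ f) (x y : H) :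
    ∑ k, ‖inner ℂ (f k) x‖ * ‖inner ℂ (e k) y‖ ≤ ‖x‖ * ‖y‖ := by
  refine (Real.sum_mul_le_sqrt_mul_sqrt _ _ _).trans ?_
  refine mul_le_mul ?_ ?_ (Real.sqrt_nonneg _) (norm_nonneg _)
  · exact Real.sqrt_le_iff.mpr ⟨norm_nonneg _, hf.sum_inner_products_le x⟩
  · exact Real.sqrt_le_iff.mpr ⟨norm_nonneg _, he.sum_inner_products_le y⟩

lemma isBoundedTransformer_cauchyTransformer {t : ℝ} (ht : t ≠ 0) {A B : H →L[ℂ] H}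
    (hA : IsSelfAdjoint A) (hB : IsSelfAdjoint B) {h : ℝ → ℂ} (hh : Continuous h) {M : ℝ}
    (hM : ∀ s, ‖h s‖ ≤ M) :
    IsBoundedTransformer (Real.pi * M / |t|) (cauchyTransformer ht hA hB hh hM) where
  norm_inner_le X e f he hf := by
    have h1 : inner ℂ f (cauchyTransformer ht hA hB hh hM X e) =
        ∫ s, h s * inner ℂ f (cauchyOp A t s (X (cauchyOp B t s e))) := by
      change matrixCoeff f e (∫ s, h s • (cauchyOp A t s * X * cauchyOp B t s)) = _
      rw [← (matrixCoeff f e).integral_comp_comm (integrable_smul_cauchyOp ht hA hB hh hM X)]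
      simp only [map_smul, smul_eq_mul, matrixCoeff_apply, mul_apply_eq_comp]
    rw [h1]
    refine (norm_integral_smul_le (t := -t) (u := t) (neg_ne_zero.mpr ht) (abs_neg t).symm hA hB hM
      (norm_nonneg X) f e fun s => ?_).trans (le_of_eq ?_)
    · rw [← adjoint_cauchyOp, ← ContinuousLinearMap.adjoint_inner_left]
      refine (norm_inner_le_norm _ _).trans ?_
      rw [mul_left_comm]
      exact mul_le_mul_of_nonneg_left (X.le_opNorm _) (norm_nonneg _)
    · rw [he, hf, abs_neg]
      ring
  norm_sum_inner_rankOne_le m e f he hf x y := by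
    set X : H →L[ℂ] H := InnerProductSpace.rankOne ℂ x y with hX
    have h1 : ∑ k, inner ℂ (f k) (cauchyTransformer ht hA hB hh hM X (e k)) =
        ∫ s, h s * ∑ k, inner ℂ (f k) (cauchyOp A t s (X (cauchyOp B t s (e k)))) := by
      change ∑ k, matrixCoeff (f k) (e k) (∫ s, h s • (cauchyOp A t s * X * cauchyOp B t s)) = _
      rw [← _root_.sum_apply, ← (∑ k, matrixCoeff (f k) (e k)).integral_comp_comm
        (integrable_smul_cauchyOp ht hA hB hh hM X)]
      simp only [map_smul, smul_eq_mul, _root_.sum_apply, matrixCoeff_apply, mul_apply_eq_comp]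
    rw [h1]
    refine (norm_integral_smul_le (t := t) (u := -t) ht (abs_neg t) hA hB hM
      zero_le_one x y fun s => ?_).trans (le_of_eq (by ring))
    rw [one_mul]
    refine le_trans ?_ (sum_norm_inner_mul_le he hf (cauchyOp A t s x) (cauchyOp B (-t) s y))
    refine (norm_sum_le _ _).trans (Finset.sum_le_sum fun k _ => le_of_eq ?_)
    rw [hX, InnerProductSpace.rankOne_apply, map_smul, inner_smul_right, norm_mul, mul_comm,
      ← adjoint_cauchyOp, ContinuousLinearMap.adjoint_inner_right, norm_inner_symm y]

lemma IsBoundedTransformer.smul {L : ℝ} {Ψ : (H →L[ℂ] H) →ₗ[ℂ] (H →L[ℂ] H)}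
    (h : IsBoundedTransformer L Ψ) (c : ℂ) : IsBoundedTransformer (‖c‖ * L) (c • Ψ) where
  norm_inner_le X e f he hf := by
    rw [LinearMap.smul_apply, _root_.smul_apply, inner_smul_right, norm_mul, mul_assoc]
    exact mul_le_mul_of_nonneg_left (h.norm_inner_le X e f he hf) (norm_nonneg _)
  norm_sum_inner_rankOne_le m e f he hf x y := by
    simp only [LinearMap.smul_apply, _root_.smul_apply, inner_smul_right, ← Finset.mul_sum]
    rw [norm_mul, mul_assoc]
    exact mul_le_mul_of_nonneg_left (h.norm_sum_inner_rankOne_le m e f he hf x y) (norm_nonneg _)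

/-- The quasicommutators `g(A) Q - Q g(B)` arise from `A Q - Q B` by a transformer bounded
by `L`. -/
def HasTransformer (A B : H →L[ℂ] H) (L : ℝ) (g : ℝ → ℂ) : Prop :=
  ∃ Ψ : (H →L[ℂ] H) →ₗ[ℂ] (H →L[ℂ] H), IsBoundedTransformer L Ψ ∧
    ∀ Q : H →L[ℂ] H, opFun g A * Q - Q * opFun g B = Ψ (A * Q - Q * B)

lemma HasTransformer.mono {A B : H →L[ℂ] H} {L₁ L₂ : ℝ} {g : ℝ → ℂ}
    (h : HasTransformer A B L₁ g) (hL : L₁ ≤ L₂) : HasTransformer A B L₂ g := by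
  obtain ⟨Ψ, hΨ, hQ⟩ := h
  refine ⟨Ψ, ⟨fun X e f he hf => (hΨ.norm_inner_le X e f he hf).trans ?_,
    fun m e f he hf x y => (hΨ.norm_sum_inner_rankOne_le m e f he hf x y).trans ?_⟩, hQ⟩
  all_goals gcongr

lemma HasTransformer.add {A B : H →L[ℂ] H} {L₁ L₂ : ℝ} {g₁ g₂ : ℝ → ℂ}
    (h₁ : HasTransformer A B L₁ g₁) (h₂ : HasTransformer A B L₂ g₂) (hg₁ : Continuous g₁)
    (hg₂ : Continuous g₂) : HasTransformer A B (L₁ + L₂) (fun x => g₁ x + g₂ x) := by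
  obtain ⟨Ψ₁, hΨ₁, hQ₁⟩ := h₁
  obtain ⟨Ψ₂, hΨ₂, hQ₂⟩ := h₂
  refine ⟨Ψ₁ + Ψ₂, hΨ₁.add hΨ₂, fun Q => ?_⟩
  rw [LinearMap.add_apply, ← hQ₁, ← hQ₂, opFun_add hg₁ hg₂, opFun_add hg₁ hg₂, add_mul, mul_add]
  abel

/-- The Poisson average of `h` at height `t`. -/
def poissonAvg (t : ℝ) (h : ℝ → ℂ) (x : ℝ) : ℂ :=
  ((t / Real.pi : ℝ) : ℂ) * ∫ s, h s * (poissonKer t s x : ℂ)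

lemma hasTransformer_poissonAvg {t : ℝ} (ht : 0 < t) {A B : H →L[ℂ] H}
    (hA : IsSelfAdjoint A) (hB : IsSelfAdjoint B) {h : ℝ → ℂ} (hh : Continuous h) {M : ℝ}
    (hM : ∀ s, ‖h s‖ ≤ M) : HasTransformer A B (M / t) (poissonAvg t h) := by
  have ht0 := ht.ne'
  have hM0 : 0 ≤ M := (norm_nonneg _).trans (hM 0)
  set c : ℂ := (2 * Real.pi * Complex.I)⁻¹ with hc
  have hpi : (Real.pi : ℂ) ≠ 0 := by exact_mod_cast Real.pi_ne_zero
  have htC : (t : ℂ) ≠ 0 := by exact_mod_cast ht0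
  have hcn : ‖c‖ = (2 * Real.pi)⁻¹ := by
    rw [hc, norm_inv, norm_mul, norm_mul, Complex.norm_I, Complex.norm_real,
      Real.norm_of_nonneg Real.pi_pos.le]
    simp
  have hker : ∀ s x, ((t / Real.pi : ℝ) : ℂ) * (h s * (poissonKer t s x : ℂ)) =
      h s * (c * (cauchyKer t s x - cauchyKer (-t) s x)) := fun s x => by
    rw [cauchyKer_sub_neg ht0, hc]
    push_cast
    have := Complex.I_ne_zero
    field_simp
  set F : ℝ → ℝ → ℂ := fun s x => h s * (c * (cauchyKer t s x - cauchyKer (-t) s x)) with hF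
  have hFcont : Continuous (Function.uncurry F) := by
    have h1 := continuous_uncurry_cauchyKer ht0
    have h2 := continuous_uncurry_cauchyKer (neg_ne_zero.mpr ht0)
    exact (hh.comp continuous_fst).mul (continuous_const.mul (h1.sub h2))
  have hav : poissonAvg t h = fun x => ∫ s, F s x := by
    funext x
    rw [poissonAvg, ← integral_const_mul]
    simp only [hker, hF]
  have hFb : ∀ r s x, |x| ≤ r → ‖F s x‖ ≤
      t / Real.pi * M * ((2 + (1 + 2 * r ^ 2) / t ^ 2) * (1 + s ^ 2)⁻¹) := fun r s x hx => by
    rw [hF]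
    simp only
    rw [← hker, norm_mul, norm_mul, Complex.norm_real,
      Real.norm_of_nonneg (by positivity), ← mul_assoc]
    have := norm_ofReal_poissonKer_le ht0 s x hx
    have := hM s
    gcongr
  have hintegral : ∀ {C : H →L[ℂ] H}, IsSelfAdjoint C → Integrable (fun s => opFun (F s) C) ∧
      opFun (poissonAvg t h) C = ∫ s, opFun (F s) C := fun {C} hC => by
    have hb := (integrable_poissonKer_bound t ‖C‖).const_mul (t / Real.pi * M)
    exact ⟨integrable_opFun hFcont hC (hFb _) hb, by rw [hav, opFun_integral hFcont hC (hFb _) hb]⟩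
  have hop : ∀ (C : H →L[ℂ] H) (s : ℝ),
      opFun (F s) C = h s • (c • (cauchyOp C t s - cauchyOp C (-t) s)) := fun C s => by
    have h1 := continuous_cauchyKer ht0 s
    have h2 := continuous_cauchyKer (neg_ne_zero.mpr ht0) s
    have h3 : Continuous fun x => cauchyKer t s x - cauchyKer (-t) s x := h1.sub h2
    have h4 : Continuous fun x => c * (cauchyKer t s x - cauchyKer (-t) s x) :=
      continuous_const.mul h3
    change opFun (fun x => h s * (c * (cauchyKer t s x - cauchyKer (-t) s x))) C = _
    rw [opFun_const_mul h4, opFun_const_mul h3, opFun_sub h1 h2]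
    rfl
  refine ⟨(-c) • cauchyTransformer ht0 hA hB hh hM +
    c • cauchyTransformer (neg_ne_zero.mpr ht0) hA hB hh hM, ?_, fun Q => ?_⟩
  · have h1 := ((isBoundedTransformer_cauchyTransformer ht0 hA hB hh hM).smul (-c)).add
      ((isBoundedTransformer_cauchyTransformer (neg_ne_zero.mpr ht0) hA hB hh hM).smul c)
    convert h1 using 1
    rw [norm_neg, hcn, abs_neg, abs_of_pos ht]
    have := Real.pi_ne_zero
    field_simp
    norm_num
  · rw [(hintegral hA).2, (hintegral hB).2, ← integral_mul_const_of_integrable (hintegral hA).1,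
      ← integral_const_mul_of_integrable (hintegral hB).1,
      ← integral_sub ((hintegral hA).1.mul_const Q) ((hintegral hB).1.const_mul Q)]
    simp only [LinearMap.add_apply, LinearMap.smul_apply]
    change _ = (-c) • (∫ s, h s • (cauchyOp A t s * (A * Q - Q * B) * cauchyOp B t s)) +
      c • ∫ s, h s • (cauchyOp A (-t) s * (A * Q - Q * B) * cauchyOp B (-t) s)
    have i1 : Integrable fun s =>
        (-c) • h s • (cauchyOp A t s * (A * Q - Q * B) * cauchyOp B t s) :=
      (integrable_smul_cauchyOp ht0 hA hB hh hM _).smul (-c)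
    have i2 : Integrable fun s =>
        c • h s • (cauchyOp A (-t) s * (A * Q - Q * B) * cauchyOp B (-t) s) :=
      (integrable_smul_cauchyOp (neg_ne_zero.mpr ht0) hA hB hh hM _).smul c
    rw [← integral_smul, ← integral_smul, ← integral_add i1 i2]
    congr 1
    funext s
    have e1 := cauchyOp_mul_sub ht0 hA hB Q s
    have e2 := cauchyOp_mul_sub (neg_ne_zero.mpr ht0) hA hB Q s
    rw [hop, hop]
    have e3 : h s • c • (cauchyOp A t s - cauchyOp A (-t) s) * Q -
        Q * h s • c • (cauchyOp B t s - cauchyOp B (-t) s) =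
        h s • c • ((cauchyOp A t s * Q - Q * cauchyOp B t s) -
          (cauchyOp A (-t) s * Q - Q * cauchyOp B (-t) s)) := by
      simp only [smul_mul_assoc, mul_smul_comm, sub_mul, mul_sub, smul_sub]
      abel
    rw [e3, e1, e2]
    simp only [smul_comm (h s) c, smul_sub, smul_neg, neg_smul]
    abel

end PoissonTransformer

section PoissonAverages

open MeasureTheory

variable {h h₁ h₂ : ℝ → ℂ} {M t : ℝ}

lemma poissonAvg_eq (ht : 0 < t) (h : ℝ → ℂ) (x : ℝ) : poissonAvg t h x =
    ((Real.pi⁻¹ : ℝ) : ℂ) * ∫ u : ℝ, h (x - t * u) * (((1 + u ^ 2)⁻¹ : ℝ) : ℂ) := by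
  rw [poissonAvg, integral_poissonKer_mul ht, ← mul_assoc]
  congr 1
  have : (t : ℂ) ≠ 0 := by exact_mod_cast ht.ne'
  push_cast
  field_simp

lemma integrable_ofReal_inv_one_add_sq :
    Integrable fun u : ℝ => (((1 + u ^ 2)⁻¹ : ℝ) : ℂ) :=
  integrable_inv_one_add_sq.ofReal

lemma integrable_mul_inv_one_add_sq (hh : Continuous h) (hM : ∀ s, ‖h s‖ ≤ M) :
    Integrable fun u : ℝ => h u * (((1 + u ^ 2)⁻¹ : ℝ) : ℂ) :=
  integrable_ofReal_inv_one_add_sq.bdd_mul hh.aestronglyMeasurable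
    (Filter.Eventually.of_forall hM)

lemma integral_ofReal_inv_one_add_sq :
    ∫ u : ℝ, (((1 + u ^ 2)⁻¹ : ℝ) : ℂ) = Real.pi := by
  rw [integral_complex_ofReal, integral_univ_inv_one_add_sq]

lemma poissonAvg_sub (ht : 0 < t) (hh₁ : Continuous h₁) (hM₁ : ∀ s, ‖h₁ s‖ ≤ M)
    (hh₂ : Continuous h₂) {M₂ : ℝ} (hM₂ : ∀ s, ‖h₂ s‖ ≤ M₂) (x : ℝ) :
    poissonAvg t (fun s => h₁ s - h₂ s) x = poissonAvg t h₁ x - poissonAvg t h₂ x := by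
  simp only [poissonAvg_eq ht, sub_mul]
  rw [integral_sub (integrable_mul_inv_one_add_sq (h := fun u => h₁ (x - t * u)) (by fun_prop)
      fun _ => hM₁ _) (integrable_mul_inv_one_add_sq (h := fun u => h₂ (x - t * u)) (by fun_prop)
      fun _ => hM₂ _), mul_sub]

lemma norm_sub_poissonAvg_le (ht : 0 < t) (hh : Continuous h) (hM : ∀ s, ‖h s‖ ≤ M) (x : ℝ) (z : ℂ)
    {b : ℝ → ℝ} (hb : Integrable fun u => b u * (1 + u ^ 2)⁻¹)
    (hle : ∀ u, ‖z - h (x - t * u)‖ ≤ b u) :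
    ‖z - poissonAvg t h x‖ ≤ Real.pi⁻¹ * ∫ u, b u * (1 + u ^ 2)⁻¹ := by
  have h1 : z - poissonAvg t h x = ((Real.pi⁻¹ : ℝ) : ℂ) *
      ∫ u : ℝ, (z - h (x - t * u)) * (((1 + u ^ 2)⁻¹ : ℝ) : ℂ) := by
    simp only [sub_mul]
    rw [integral_sub (integrable_ofReal_inv_one_add_sq.const_mul z)
      (integrable_mul_inv_one_add_sq (h := fun u => h (x - t * u)) (by fun_prop) fun _ => hM _),
      mul_sub, ← poissonAvg_eq ht, integral_const_mul, integral_ofReal_inv_one_add_sq]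
    have : (Real.pi : ℂ) ≠ 0 := by exact_mod_cast Real.pi_ne_zero
    push_cast
    field_simp
  rw [h1, norm_mul, Complex.norm_real, Real.norm_of_nonneg (by positivity)]
  gcongr
  refine norm_integral_le_of_norm_le hb (Filter.Eventually.of_forall fun u => ?_)
  rw [norm_mul, Complex.norm_real, Real.norm_of_nonneg (by positivity)]
  gcongr
  exact hle u

lemma norm_poissonAvg_le (ht : 0 < t) (hh : Continuous h) (hM : ∀ s, ‖h s‖ ≤ M) (x : ℝ) :
    ‖poissonAvg t h x‖ ≤ M := by
  have := norm_sub_poissonAvg_le ht hh hM x 0 (b := fun _ => M)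
    (integrable_inv_one_add_sq.const_mul M) fun u => by simpa using hM _
  rw [zero_sub, norm_neg, integral_const_mul, integral_univ_inv_one_add_sq] at this
  convert this using 1
  field_simp

lemma continuous_poissonAvg (ht : 0 < t) (hh : Continuous h) (hM : ∀ s, ‖h s‖ ≤ M) :
    Continuous (poissonAvg t h) := by
  rw [funext (poissonAvg_eq ht h)]
  refine continuous_const.mul (continuous_of_dominated (bound := fun u => M * (1 + u ^ 2)⁻¹)
    (fun x => ?_) (fun x => Filter.Eventually.of_forall fun u => ?_)
    (integrable_inv_one_add_sq.const_mul M) (Filter.Eventually.of_forall fun u => by fun_prop))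
  · exact (integrable_mul_inv_one_add_sq (h := fun u => h (x - t * u)) (by fun_prop)
      fun _ => hM _).aestronglyMeasurable
  · rw [norm_mul, Complex.norm_real, Real.norm_of_nonneg (by positivity)]
    gcongr
    exact hM _

lemma poissonAvg_comm {s : ℝ} (ht : 0 < t) (hs : 0 < s) (hh : Continuous h)
    (hM : ∀ s, ‖h s‖ ≤ M) (x : ℝ) :
    poissonAvg t (poissonAvg s h) x = poissonAvg s (poissonAvg t h) x := by
  simp only [poissonAvg_eq ht, poissonAvg_eq hs, mul_assoc, integral_const_mul]
  congr 2
  simp only [← integral_mul_const]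
  rw [integral_integral_swap]
  · congr 1
    funext v
    congr 1
    funext u
    rw [mul_right_comm, sub_right_comm]
  · have h1 : Integrable (fun z : ℝ × ℝ => (((1 + z.1 ^ 2)⁻¹ : ℝ) : ℂ) *
        (((1 + z.2 ^ 2)⁻¹ : ℝ) : ℂ)) (volume.prod volume) :=
      integrable_ofReal_inv_one_add_sq.mul_prod integrable_ofReal_inv_one_add_sq
    have h2 : Continuous fun z : ℝ × ℝ => h (x - t * z.1 - s * z.2) := by fun_prop
    refine (h1.bdd_mul h2.aestronglyMeasurable (Filter.Eventually.of_forall fun _ => hM _)).congr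
      (Filter.Eventually.of_forall fun z => ?_)
    simp only [Function.uncurry]
    ring

lemma integrable_abs_rpow_mul_inv_one_add_sq {α : ℝ} (hα0 : 0 < α) (hα1 : α < 1) :
    Integrable fun u : ℝ => |u| ^ α * (1 + u ^ 2)⁻¹ := by
  have h1 : Integrable fun u : ℝ => (1 + ‖u‖ ^ 2) ^ (-(2 - α) / 2) :=
    integrable_rpow_neg_one_add_norm_sq (by simp; linarith)
  have hc : Continuous fun u : ℝ => |u| ^ α * (1 + u ^ 2)⁻¹ :=
    (continuous_abs.rpow_const fun _ => Or.inr hα0.le).mul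
      (Continuous.inv₀ (by fun_prop) fun u => by positivity)
  refine h1.mono' hc.aestronglyMeasurable (Filter.Eventually.of_forall fun u => ?_)
  rw [Real.norm_of_nonneg (by positivity), Real.norm_eq_abs, sq_abs]
  have hu : |u| ^ α ≤ (1 + u ^ 2) ^ (α / 2) := by
    rw [← Real.sqrt_sq_eq_abs, Real.sqrt_eq_rpow, ← Real.rpow_mul (sq_nonneg u)]
    rw [one_div_mul_eq_div]
    exact Real.rpow_le_rpow (sq_nonneg u) (by linarith) (by positivity)
  calc |u| ^ α * (1 + u ^ 2)⁻¹ ≤ (1 + u ^ 2) ^ (α / 2) * (1 + u ^ 2)⁻¹ := by gcongr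
    _ = (1 + u ^ 2) ^ (-(2 - α) / 2) := by
      rw [← Real.rpow_neg_one, ← Real.rpow_add (by positivity)]
      congr 1
      ring

/-- The constant in the Poisson approximation of Hölder functions. -/
def hoelderConst (α : ℝ) : ℝ := Real.pi⁻¹ * ∫ u : ℝ, |u| ^ α * (1 + u ^ 2)⁻¹

lemma hoelderConst_nonneg (α : ℝ) : 0 ≤ hoelderConst α :=
  mul_nonneg (by positivity) (integral_nonneg fun u => by positivity)

lemma norm_sub_poissonAvg_le_of_hoelderWith {α C : ℝ} (hα0 : 0 < α) (hα1 : α < 1) (ht : 0 < t)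
    (hh : Continuous h) (hM : ∀ s, ‖h s‖ ≤ M) (hC : HoelderWith C α h) (x : ℝ) :
    ‖h x - poissonAvg t h x‖ ≤ hoelderConst α * C * t ^ α := by
  have hi := (integrable_abs_rpow_mul_inv_one_add_sq hα0 hα1).const_mul (C * t ^ α)
  simp only [← mul_assoc] at hi
  refine (norm_sub_poissonAvg_le ht hh hM x (h x) hi fun u => ?_).trans (le_of_eq ?_)
  · refine (hC _ _).trans (le_of_eq ?_)
    rw [sub_sub_cancel, abs_mul, abs_of_pos ht, Real.mul_rpow ht.le (abs_nonneg _), mul_assoc]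
  · simp only [mul_assoc, integral_const_mul, hoelderConst]
    ring

lemma norm_poissonAvg_sub_poissonAvg_le {α C : ℝ} (hα0 : 0 < α) (hα1 : α < 1) (hC0 : 0 ≤ C)
    (ht : 0 < t) (hh : Continuous h) (hM : ∀ s, ‖h s‖ ≤ M) (hC : HoelderWith C α h) (x : ℝ) :
    ‖poissonAvg t h x - poissonAvg (2 * t) h x‖ ≤ 3 * hoelderConst α * C * t ^ α := by
  have h1 := norm_sub_poissonAvg_le_of_hoelderWith hα0 hα1 ht hh hM hC x
  have h2 := norm_sub_poissonAvg_le_of_hoelderWith hα0 hα1 (mul_pos two_pos ht) hh hM hC x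
  have h3 : (2 * t) ^ α ≤ 2 * t ^ α := by
    rw [Real.mul_rpow two_pos.le ht.le]
    gcongr
    exact Real.rpow_le_self_of_one_le one_le_two hα1.le
  have h4 : hoelderConst α * C * (2 * t) ^ α ≤ hoelderConst α * C * (2 * t ^ α) :=
    mul_le_mul_of_nonneg_left h3 (mul_nonneg (hoelderConst_nonneg α) hC0)
  have h5 := norm_sub_le (h x - poissonAvg (2 * t) h x) (h x - poissonAvg t h x)
  rw [sub_sub_sub_cancel_left] at h5
  linarith

lemma norm_sub_poissonAvg_poissonAvg_le {α C : ℝ} (hα0 : 0 < α) (hα1 : α < 1) (ht : 0 < t)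
    (hh : Continuous h) (hM : ∀ s, ‖h s‖ ≤ M) (hC : HoelderWith C α h) (x : ℝ) :
    ‖h x - poissonAvg t (poissonAvg t h) x‖ ≤ 2 * (hoelderConst α * C * t ^ α) := by
  have h1 := norm_sub_poissonAvg_le_of_hoelderWith hα0 hα1 ht hh hM hC
  have hc := continuous_poissonAvg ht hh hM
  have h2 := norm_poissonAvg_le ht (hh.sub hc) h1 x
  have h3 := poissonAvg_sub ht hh hM hc (norm_poissonAvg_le ht hh hM) x
  have h4 : h x - poissonAvg t (poissonAvg t h) x = (h x - poissonAvg t h x) +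
      (poissonAvg t h x - poissonAvg t (poissonAvg t h) x) := by ring
  rw [h4, two_mul, ← h3]
  exact (norm_add_le _ _).trans (add_le_add (h1 x) h2)

end PoissonAverages

section HoelderQuasicommutators

open Filter Topology

variable {H : Type} [NormedAddCommGroup H] [InnerProductSpace ℂ H] [CompleteSpace H]

/-- The sum of the geometric series with ratio `2 ^ (α - 1)`. -/
def geomConst (α : ℝ) : ℝ := (1 - (2 : ℝ) ^ (α - 1))⁻¹

lemma two_rpow_sub_one_lt_one {α : ℝ} (hα1 : α < 1) : (2 : ℝ) ^ (α - 1) < 1 :=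
  Real.rpow_lt_one_of_one_lt_of_neg one_lt_two (by linarith)

lemma geomConst_nonneg {α : ℝ} (hα1 : α < 1) : 0 ≤ geomConst α :=
  inv_nonneg.mpr (sub_nonneg.mpr (two_rpow_sub_one_lt_one hα1).le)

lemma one_add_mul_geomConst {α : ℝ} (hα1 : α < 1) :
    1 + (2 : ℝ) ^ (α - 1) * geomConst α = geomConst α := by
  have h : (1 : ℝ) - (2 : ℝ) ^ (α - 1) ≠ 0 := (sub_pos.mpr (two_rpow_sub_one_lt_one hα1)).ne'
  rw [geomConst]
  field_simp
  ring

lemma poissonAvg_poissonAvg_eq {h : ℝ → ℂ} {M t : ℝ} (ht : 0 < t) (hh : Continuous h)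
    (hM : ∀ s, ‖h s‖ ≤ M) (x : ℝ) : poissonAvg t (poissonAvg t h) x =
      (poissonAvg t (fun s => poissonAvg t h s - poissonAvg (2 * t) h s) x +
        poissonAvg (2 * t) (fun s => poissonAvg t h s - poissonAvg (2 * t) h s) x) +
      poissonAvg (2 * t) (poissonAvg (2 * t) h) x := by
  have ht2 : 0 < 2 * t := by positivity
  have h1 := continuous_poissonAvg ht hh hM
  have h2 := continuous_poissonAvg ht2 hh hM
  have b1 := norm_poissonAvg_le ht hh hM
  have b2 := norm_poissonAvg_le ht2 hh hM
  rw [poissonAvg_sub ht h1 b1 h2 b2, poissonAvg_sub ht2 h1 b1 h2 b2,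
    poissonAvg_comm ht2 ht hh hM]
  ring

lemma hasTransformer_poissonAvg_poissonAvg {α C : ℝ} (hα0 : 0 < α) (hα1 : α < 1) (hC0 : 0 ≤ C)
    {A B : H →L[ℂ] H} (hA : IsSelfAdjoint A) (hB : IsSelfAdjoint B) {h : ℝ → ℂ} {M : ℝ}
    (hh : Continuous h) (hM : ∀ s, ‖h s‖ ≤ M) (hC : HoelderWith C α h) (K : ℕ) {t : ℝ}
    (ht : 0 < t) : HasTransformer A B
      (6 * hoelderConst α * C * geomConst α * t ^ (α - 1) + M / (2 ^ K * t))
      (poissonAvg t (poissonAvg t h)) := by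
  have hκ := hoelderConst_nonneg α
  have hg0 := geomConst_nonneg hα1
  induction K generalizing t with
  | zero =>
    refine (hasTransformer_poissonAvg ht hA hB (continuous_poissonAvg ht hh hM)
      (norm_poissonAvg_le ht hh hM)).mono ?_
    rw [pow_zero, one_mul]
    exact le_add_of_nonneg_left (by positivity)
  | succ K ih =>
    have ht2 : 0 < 2 * t := by positivity
    have h1 := continuous_poissonAvg ht hh hM
    have h2 := continuous_poissonAvg ht2 hh hM
    have h3 : Continuous fun s => poissonAvg t h s - poissonAvg (2 * t) h s := h1.sub h2
    have b3 := norm_poissonAvg_sub_poissonAvg_le hα0 hα1 hC0 ht hh hM hC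
    have c1 := continuous_poissonAvg ht h3 b3
    have c2 := continuous_poissonAvg ht2 h3 b3
    have c3 := continuous_poissonAvg ht2 h2 (norm_poissonAvg_le ht2 hh hM)
    have key := ((hasTransformer_poissonAvg ht hA hB h3 b3).add
      (hasTransformer_poissonAvg ht2 hA hB h3 b3) c1 c2).add (ih ht2) (c1.add c2) c3
    rw [funext (poissonAvg_poissonAvg_eq ht hh hM)]
    refine key.mono ?_
    have e1 : t ^ α / t = t ^ (α - 1) := by rw [Real.rpow_sub_one ht.ne']
    have e2 : (2 * t) ^ (α - 1) = 2 ^ (α - 1) * t ^ (α - 1) := Real.mul_rpow two_pos.le ht.le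
    have e3 : M / (2 ^ K * (2 * t)) = M / (2 ^ (K + 1) * t) := by rw [pow_succ, mul_assoc]
    have e4 := one_add_mul_geomConst hα1
    have e5 : 3 * hoelderConst α * C * t ^ α / t = 3 * hoelderConst α * C * t ^ (α - 1) := by
      rw [← e1]; ring
    have e6 : 3 * hoelderConst α * C * t ^ α / (2 * t) ≤
        3 * hoelderConst α * C * t ^ (α - 1) := by
      rw [← e5]
      gcongr
      linarith
    rw [e2, e3, e5]
    have e7 : 6 * hoelderConst α * C * geomConst α * t ^ (α - 1) =
        6 * hoelderConst α * C * t ^ (α - 1) +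
          6 * hoelderConst α * C * geomConst α * (2 ^ (α - 1) * t ^ (α - 1)) := by
      nth_rewrite 1 [← e4]
      ring
    linarith

/-- The dyadic averages `2⁻ᴺ ∑_{n ≤ N} 2ⁿ d(2ⁿ - 1)`. -/
def dyadicMean (d : ℕ → ℝ) (N : ℕ) : ℝ :=
  (∑ n ∈ Finset.range (N + 1), 2 ^ n * d (2 ^ n - 1)) / 2 ^ N

lemma dyadicMean_nonneg {d : ℕ → ℝ} (hd : ∀ n, 0 ≤ d n) (N : ℕ) : 0 ≤ dyadicMean d N :=
  div_nonneg (Finset.sum_nonneg fun n _ => mul_nonneg (by positivity) (hd _)) (by positivity)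

/-- The constant in the singular value estimate for quasicommutators. -/
def quasiConst (α : ℝ) : ℝ := 36 * hoelderConst α * geomConst α + 4 * hoelderConst α

lemma quasiConst_nonneg {α : ℝ} (hα1 : α < 1) : 0 ≤ quasiConst α := by
  have := hoelderConst_nonneg α
  have := geomConst_nonneg hα1
  unfold quasiConst
  positivity

lemma sVal_quasicommutator_le_of_bounded {α C : ℝ} (hα0 : 0 < α) (hα1 : α < 1) (hC0 : 0 ≤ C)
    {A B : H →L[ℂ] H} (hA : IsSelfAdjoint A) (hB : IsSelfAdjoint B) {h : ℝ → ℂ} {M : ℝ}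
    (hh : Continuous h) (hM : ∀ s, ‖h s‖ ≤ M) (hC : HoelderWith C α h) (Q : H →L[ℂ] H) (N : ℕ)
    {t : ℝ} (ht : 0 < t) : sVal (opFun h A * Q - Q * opFun h B) (2 * (2 ^ N - 1)) ≤
      quasiConst α * C * (t ^ (α - 1) * dyadicMean (sVal (A * Q - Q * B)) N + t ^ α * ‖Q‖) := by
  have hκ := hoelderConst_nonneg α
  have hg0 := geomConst_nonneg hα1
  have hM0 : 0 ≤ M := (norm_nonneg _).trans (hM 0)
  set τ := dyadicMean (sVal (A * Q - Q * B)) N with hτ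
  have hτ0 : 0 ≤ τ := dyadicMean_nonneg (sVal_nonneg _) N
  set g : ℝ → ℂ := poissonAvg t (poissonAvg t h) with hg
  have hgc : Continuous g :=
    continuous_poissonAvg ht (continuous_poissonAvg ht hh hM) (norm_poissonAvg_le ht hh hM)
  set r : ℝ → ℂ := fun x => h x - g x with hr
  have hrb : ∀ x, ‖r x‖ ≤ 2 * (hoelderConst α * C * t ^ α) :=
    norm_sub_poissonAvg_poissonAvg_le hα0 hα1 ht hh hM hC
  have hE : ‖opFun r A * Q - Q * opFun r B‖ ≤ 4 * hoelderConst α * C * (t ^ α * ‖Q‖) := by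
    have n1 := norm_opFun_le (by positivity) hrb A
    have n2 := norm_opFun_le (by positivity) hrb B
    calc ‖opFun r A * Q - Q * opFun r B‖ ≤ ‖opFun r A‖ * ‖Q‖ + ‖Q‖ * ‖opFun r B‖ :=
          (norm_sub_le _ _).trans (add_le_add (norm_mul_le _ _) (norm_mul_le _ _))
      _ ≤ 2 * (hoelderConst α * C * t ^ α) * ‖Q‖ + ‖Q‖ * (2 * (hoelderConst α * C * t ^ α)) := by
          gcongr
      _ = 4 * hoelderConst α * C * (t ^ α * ‖Q‖) := by ring
  have hsplit : opFun h A * Q - Q * opFun h B =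
      (opFun g A * Q - Q * opFun g B) + (opFun r A * Q - Q * opFun r B) := by
    rw [hr, opFun_sub hh hgc, opFun_sub hh hgc, sub_mul, mul_sub]
    abel
  have hK : ∀ K : ℕ, sVal (opFun h A * Q - Q * opFun h B) (2 * (2 ^ N - 1)) ≤
      6 * (6 * hoelderConst α * C * geomConst α * t ^ (α - 1) + M / t * (1 / 2) ^ K) * τ +
        4 * hoelderConst α * C * (t ^ α * ‖Q‖) := fun K => by
    obtain ⟨Ψ, hΨ, hΨQ⟩ :=
      hasTransformer_poissonAvg_poissonAvg hα0 hα1 hC0 hA hB hh hM hC K ht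
    rw [hsplit, hΨQ]
    have e : M / (2 ^ K * t) = M / t * (1 / 2) ^ K := by
      rw [one_div, inv_pow]
      field_simp
    rw [e] at hΨ
    exact (hΨ.sVal_add_le (by positivity) _ _ N).trans (add_le_add le_rfl hE)
  have hlim : Tendsto (fun K : ℕ =>
      6 * (6 * hoelderConst α * C * geomConst α * t ^ (α - 1) + M / t * (1 / 2) ^ K) * τ +
        4 * hoelderConst α * C * (t ^ α * ‖Q‖)) atTop
      (𝓝 (6 * (6 * hoelderConst α * C * geomConst α * t ^ (α - 1) + M / t * 0) * τ +
        4 * hoelderConst α * C * (t ^ α * ‖Q‖))) := by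
    have h0 : Tendsto (fun K : ℕ => (1 / 2 : ℝ) ^ K) atTop (𝓝 0) :=
      tendsto_pow_atTop_nhds_zero_of_lt_one (by norm_num) (by norm_num)
    exact ((((h0.const_mul _).const_add _).const_mul _).mul_const _).add_const _
  refine (ge_of_tendsto' hlim hK).trans ?_
  have p1 : 0 ≤ hoelderConst α * geomConst α * C * (t ^ α * ‖Q‖) := by positivity
  have p2 : 0 ≤ hoelderConst α * C * (t ^ (α - 1) * τ) := by positivity
  rw [quasiConst]
  nlinarith

lemma HoelderWith.continuous {C α : ℝ} (hα0 : 0 < α) {f : ℝ → ℂ} (hf : HoelderWith C α f) :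
    Continuous f := by
  refine continuous_iff_continuousAt.mpr fun x => ?_
  rw [ContinuousAt, tendsto_iff_norm_sub_tendsto_zero]
  have h1 : Tendsto (fun y : ℝ => C * |y - x| ^ α) (𝓝 x) (𝓝 0) := by
    have : Continuous fun y : ℝ => C * |y - x| ^ α :=
      continuous_const.mul ((continuous_id.sub continuous_const).abs.rpow_const
        fun _ => Or.inr hα0.le)
    simpa [Real.zero_rpow hα0.ne'] using this.tendsto x
  exact squeeze_zero (fun _ => norm_nonneg _) (fun y => hf y x) h1

lemma sVal_quasicommutator_le_add {α C : ℝ} (hα0 : 0 < α) (hα1 : α < 1) (hC0 : 0 ≤ C)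
    {A B : H →L[ℂ] H} (hA : IsSelfAdjoint A) (hB : IsSelfAdjoint B) {f : ℝ → ℂ}
    (hC : HoelderWith C α f) (Q : H →L[ℂ] H) (N : ℕ) {t : ℝ} (ht : 0 < t) :
    sVal (opFun f A * Q - Q * opFun f B) (2 * (2 ^ N - 1)) ≤
      quasiConst α * C * (t ^ (α - 1) * dyadicMean (sVal (A * Q - Q * B)) N + t ^ α * ‖Q‖) := by
  set R : ℝ := max ‖A‖ ‖B‖ with hR
  have hR0 : 0 ≤ R := (norm_nonneg A).trans (le_max_left _ _)
  have hfc := hC.continuous hα0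
  set h : ℝ → ℂ := fun x => f (max (-R) (min x R)) - f 0 with hh
  have hhc : Continuous h := by fun_prop
  have hhC : HoelderWith C α h := fun x y => by
    simp only [hh, sub_sub_sub_cancel_right]
    have hle : |max (-R) (min x R) - max (-R) (min y R)| ≤ |x - y| := by
      refine (abs_max_sub_max_le_max _ _ _ _).trans ?_
      rw [sub_self, abs_zero, max_eq_right (abs_nonneg _)]
      refine (abs_min_sub_min_le_max _ _ _ _).trans ?_
      rw [sub_self, abs_zero, max_eq_left (abs_nonneg _)]
    exact (hC _ _).trans (mul_le_mul_of_nonneg_left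
      (Real.rpow_le_rpow (abs_nonneg _) hle hα0.le) hC0)
  have hhM : ∀ x, ‖h x‖ ≤ C * R ^ α := fun x => by
    refine (hC _ _).trans ?_
    gcongr
    rw [sub_zero, abs_le]
    exact ⟨le_max_left _ _, max_le (by linarith) (min_le_right _ _)⟩
  have hop : ∀ {D : H →L[ℂ] H}, IsSelfAdjoint D → ‖D‖ ≤ R →
      opFun h D = opFun f D - f 0 • (1 : H →L[ℂ] H) := fun {D} hD hDR => by
    rw [← opFun_const (f 0) hD, ← opFun_sub hfc continuous_const]
    refine opFun_congr fun x hx => ?_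
    have hx := abs_le.mp (hx.trans hDR)
    simp only [hh, min_eq_left hx.2, max_eq_right hx.1]
  have := sVal_quasicommutator_le_of_bounded hα0 hα1 hC0 hA hB hhc hhM hhC Q N ht
  rw [hop hA (le_max_left _ _), hop hB (le_max_right _ _)] at this
  convert this using 2
  simp only [sub_mul, mul_sub, smul_mul_assoc, mul_smul_comm, one_mul, mul_one]
  abel

lemma sVal_zero (j : ℕ) : sVal (0 : H →L[ℂ] H) j = 0 := by
  refine le_antisymm ?_ (sVal_nonneg _ _)
  have := sVal_le (0 : H →L[ℂ] H) (R := 0) (j := j) (by simp)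
  simpa using this

lemma sVal_quasicommutator_le {α C : ℝ} (hα0 : 0 < α) (hα1 : α < 1) (hC0 : 0 ≤ C)
    {A B : H →L[ℂ] H} (hA : IsSelfAdjoint A) (hB : IsSelfAdjoint B) {f : ℝ → ℂ}
    (hC : HoelderWith C α f) (Q : H →L[ℂ] H) (N : ℕ) :
    sVal (opFun f A * Q - Q * opFun f B) (2 * (2 ^ N - 1)) ≤
      2 * quasiConst α * C * ‖Q‖ ^ (1 - α) * dyadicMean (sVal (A * Q - Q * B)) N ^ α := by
  have hq := quasiConst_nonneg hα1
  set τ := dyadicMean (sVal (A * Q - Q * B)) N with hτ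
  have hτ0 : 0 ≤ τ := dyadicMean_nonneg (sVal_nonneg _) N
  rcases eq_or_ne Q 0 with rfl | hQ
  · rw [mul_zero, zero_mul, sub_zero, sVal_zero]
    positivity
  have hQ0 : 0 < ‖Q‖ := norm_pos_iff.mpr hQ
  have hlim : Tendsto (fun y : ℝ => 2 * quasiConst α * C * ‖Q‖ ^ (1 - α) * y ^ α) (𝓝[>] τ)
      (𝓝 (2 * quasiConst α * C * ‖Q‖ ^ (1 - α) * τ ^ α)) :=
    ((Real.continuous_rpow_const hα0.le).tendsto τ |>.const_mul _).mono_left nhdsWithin_le_nhds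
  refine ge_of_tendsto hlim (eventually_nhdsWithin_of_forall fun y (hy : τ < y) => ?_)
  have hy0 : 0 < y := hτ0.trans_lt hy
  refine (sVal_quasicommutator_le_add hα0 hα1 hC0 hA hB hC Q N (div_pos hy0 hQ0)).trans ?_
  have e1 : (y / ‖Q‖) ^ (α - 1) * y = ‖Q‖ ^ (1 - α) * y ^ α := by
    rw [Real.div_rpow hy0.le hQ0.le, Real.rpow_sub_one hy0.ne', ← neg_sub 1 α,
      Real.rpow_neg hQ0.le]
    field_simp
  have e2 : (y / ‖Q‖) ^ α * ‖Q‖ = ‖Q‖ ^ (1 - α) * y ^ α := by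
    rw [Real.div_rpow hy0.le hQ0.le, Real.rpow_sub hQ0, Real.rpow_one]
    field_simp
  calc quasiConst α * C * ((y / ‖Q‖) ^ (α - 1) * τ + (y / ‖Q‖) ^ α * ‖Q‖)
      ≤ quasiConst α * C * ((y / ‖Q‖) ^ (α - 1) * y + (y / ‖Q‖) ^ α * ‖Q‖) := by gcongr
    _ = 2 * quasiConst α * C * ‖Q‖ ^ (1 - α) * y ^ α := by rw [e1, e2]; ring

lemma HoelderWith.of_memHoelder {α : ℝ} {f : ℝ → ℂ} (hf : MemHoelder α f) :
    0 ≤ hoelderNorm α f ∧ HoelderWith (hoelderNorm α f) α f := by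
  refine ⟨Real.sInf_nonneg fun C hC => hC.1, fun x y => ?_⟩
  rcases (Real.rpow_nonneg (abs_nonneg (x - y)) α).eq_or_lt with h0 | h0
  · obtain ⟨C, -, hC⟩ := hf
    simpa [← h0] using hC x y
  · rw [← div_le_iff₀ h0]
    exact le_csInf hf fun C hC => (div_le_iff₀ h0).mpr (hC.2 x y)

end HoelderQuasicommutators

section DyadicSummation

open scoped ENNReal

lemma tsum_sum_range_pow_mul (r : ℝ≥0∞) (c : ℕ → ℝ≥0∞) :
    ∑' N, ∑ n ∈ Finset.range (N + 1), r ^ (N - n) * c n = (1 - r)⁻¹ * ∑' n, c n := by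
  have h1 : ∀ N, ∑ n ∈ Finset.range (N + 1), r ^ (N - n) * c n =
      ∑' x : Finset.HasAntidiagonal.antidiagonal N, r ^ x.1.2 * c x.1.1 := fun N => by
    rw [Finset.tsum_subtype (Finset.HasAntidiagonal.antidiagonal N) fun x : ℕ × ℕ => r ^ x.2 * c x.1,
      Finset.Nat.sum_antidiagonal_eq_sum_range_succ fun i j => r ^ j * c i]
  simp only [h1]
  rw [← ENNReal.tsum_sigma' fun x : (N : ℕ) × Finset.HasAntidiagonal.antidiagonal N => r ^ x.2.1.2 * c x.2.1.1,
    ← Finset.HasAntidiagonal.sigmaAntidiagonalEquivProd.symm.tsum_eq]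
  change ∑' x : ℕ × ℕ, r ^ x.2 * c x.1 = _
  rw [ENNReal.tsum_prod (f := fun i j => r ^ j * c i)]
  simp only [ENNReal.tsum_mul_right, ENNReal.tsum_mul_left, ENNReal.tsum_geometric]

/-- Discrete Hardy inequality. -/
lemma tsum_sum_range_pow_mul_rpow_le (r : ℝ≥0∞) (a : ℕ → ℝ≥0∞) {p : ℝ} (hp : 1 ≤ p) :
    ∑' N, (∑ n ∈ Finset.range (N + 1), r ^ (N - n) * a n) ^ p ≤
      (1 - r)⁻¹ ^ p * ∑' n, a n ^ p := by
  have hp0 : 0 < p := one_pos.trans_le hp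
  have h1 : ∀ N, (∑ n ∈ Finset.range (N + 1), r ^ (N - n) * a n) ^ p ≤
      (1 - r)⁻¹ ^ (p - 1) * ∑ n ∈ Finset.range (N + 1), r ^ (N - n) * a n ^ p := fun N => by
    have h2 : ∑ n ∈ Finset.range (N + 1), r ^ (N - n) ≤ (1 - r)⁻¹ := by
      have := Finset.sum_range_reflect (fun n => r ^ n) (N + 1)
      simp only [Nat.add_sub_cancel] at this
      rw [this, ← ENNReal.tsum_geometric]
      exact ENNReal.sum_le_tsum _
    have h3 := ENNReal.rpow_le_rpow (ENNReal.inner_le_weight_mul_Lp_of_nonneg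
      (Finset.range (N + 1)) hp (fun n => r ^ (N - n)) a) hp0.le
    rw [ENNReal.mul_rpow_of_nonneg _ _ hp0.le, ← ENNReal.rpow_mul, ← ENNReal.rpow_mul,
      inv_mul_cancel₀ hp0.ne', ENNReal.rpow_one, sub_mul, one_mul, inv_mul_cancel₀ hp0.ne'] at h3
    refine h3.trans (mul_le_mul_left ?_ _)
    exact ENNReal.rpow_le_rpow h2 (by linarith)
  refine (ENNReal.tsum_le_tsum h1).trans (le_of_eq ?_)
  rw [ENNReal.tsum_mul_left, tsum_sum_range_pow_mul, ← mul_assoc]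
  congr 1
  have := ENNReal.rpow_add_of_nonneg (x := (1 - r)⁻¹) (p - 1) 1 (by linarith) zero_le_one
  rw [sub_add_cancel, ENNReal.rpow_one] at this
  exact this.symm

lemma tsum_le_two_mul_tsum_condensed {f : ℕ → ℝ≥0∞} (hf : Antitone f) :
    ∑' k, f k ≤ 2 * ∑' k, 2 ^ k * f (2 ^ k - 1) := by
  have h1 := ENNReal.le_tsum_condensed (f := fun k => f (k - 1))
    fun m n _ hmn => hf (Nat.sub_le_sub_right hmn 1)
  have h2 : ∑' k, f k ≤ ∑' k, f (k - 1) := by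
    rw [tsum_eq_zero_add' (f := fun k => f (k - 1)) ENNReal.summable]
    exact le_add_self
  have h3 : f (0 - 1) ≤ ∑' k, 2 ^ k * f (2 ^ k - 1) :=
    le_trans (by simp) (ENNReal.le_tsum 0)
  rw [two_mul]
  exact h2.trans (h1.trans (add_le_add_left h3 _))

lemma tsum_condensed_le_five_mul_tsum {f : ℕ → ℝ≥0∞} (hf : Antitone f) :
    ∑' k, 2 ^ k * f (2 ^ k - 1) ≤ 5 * ∑' k, f k := by
  have h1 := ENNReal.tsum_condensed_le (f := fun k => f (k - 1))
    fun m n _ hmn => hf (Nat.sub_le_sub_right hmn 1)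
  have h2 : ∑' k, f (k - 1) = f 0 + ∑' k, f k := by
    rw [tsum_eq_zero_add' ENNReal.summable]
    rfl
  have h3 : f 0 ≤ ∑' k, f k := ENNReal.le_tsum 0
  rw [h2] at h1
  refine h1.trans ?_
  calc f 0 + 2 * (f 0 + ∑' k, f k) ≤ ∑' k, f k + 2 * (∑' k, f k + ∑' k, f k) := by gcongr
    _ = 5 * ∑' k, f k := by ring

/-- The ratio `2 ^ (1 / p - 1)` in the discrete Hardy inequality. -/
def hardyRatio (p : ℝ) : ℝ := 2 ^ (p⁻¹ - 1)

lemma two_pow_mul_dyadicMean_rpow {d : ℕ → ℝ} (hd : ∀ n, 0 ≤ d n) {p : ℝ} (hp : 1 < p) (N : ℕ) :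
    2 ^ N * ENNReal.ofReal (dyadicMean d N) ^ p =
      (∑ n ∈ Finset.range (N + 1), ENNReal.ofReal (hardyRatio p) ^ (N - n) *
        ENNReal.ofReal ((2 ^ n) ^ p⁻¹ * d (2 ^ n - 1))) ^ p := by
  have hp0 : 0 < p := one_pos.trans hp
  have hr : 0 ≤ hardyRatio p := by unfold hardyRatio; positivity
  have h1 : (2 : ℝ≥0∞) ^ N = ENNReal.ofReal ((2 ^ N) ^ p⁻¹) ^ p := by
    rw [ENNReal.ofReal_rpow_of_nonneg (by positivity) hp0.le, ← Real.rpow_mul (by positivity),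
      inv_mul_cancel₀ hp0.ne', Real.rpow_one, ENNReal.ofReal_pow two_pos.le]
    simp
  rw [h1, ← ENNReal.mul_rpow_of_nonneg _ _ hp0.le, ← ENNReal.ofReal_mul (by positivity)]
  simp only [← ENNReal.ofReal_pow hr, ← ENNReal.ofReal_mul (pow_nonneg hr _)]
  rw [← ENNReal.ofReal_sum_of_nonneg fun n _ =>
    mul_nonneg (pow_nonneg hr _) (mul_nonneg (by positivity) (hd _))]
  congr 2
  rw [dyadicMean, Finset.sum_div, Finset.mul_sum]
  refine Finset.sum_congr rfl fun n hn => ?_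
  have hnN : n ≤ N := Nat.lt_succ_iff.mp (Finset.mem_range.mp hn)
  obtain ⟨k, rfl⟩ := Nat.exists_eq_add_of_le hnN
  have h2 : hardyRatio p ^ k = (2 ^ k) ^ p⁻¹ / 2 ^ k := by
    rw [hardyRatio, Real.rpow_sub_one two_ne_zero, div_pow, ← Real.rpow_natCast, ← Real.rpow_mul
      two_pos.le, mul_comm, Real.rpow_mul two_pos.le, Real.rpow_natCast]
  rw [Nat.add_sub_cancel_left, h2, pow_add, Real.mul_rpow (by positivity) (by positivity)]
  field_simp

/-- The constant in `tsum_rpow_le_of_dyadicMean`. -/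
def sumConst (p : ℝ) : ℝ := 30 * (1 - hardyRatio p)⁻¹ ^ p

lemma hardyRatio_lt_one {p : ℝ} (hp : 1 < p) : hardyRatio p < 1 :=
  Real.rpow_lt_one_of_one_lt_of_neg one_lt_two (by linarith [inv_lt_one_of_one_lt₀ hp])

lemma sumConst_pos {p : ℝ} (hp : 1 < p) : 0 < sumConst p :=
  mul_pos (by norm_num)
    (Real.rpow_pos_of_pos (inv_pos.mpr (sub_pos.mpr (hardyRatio_lt_one hp))) _)

lemma tsum_ofReal_dyadicMean_le {d : ℕ → ℝ} (hd : ∀ n, 0 ≤ d n) (hda : Antitone d) {p : ℝ}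
    (hp : 1 < p) : 6 * ∑' N, 2 ^ N * ENNReal.ofReal (dyadicMean d N) ^ p ≤
      ENNReal.ofReal (sumConst p) * ∑' n, ENNReal.ofReal (d n) ^ p := by
  have hp0 : 0 < p := one_pos.trans hp
  have hr := hardyRatio_lt_one hp
  have hr0 : 0 ≤ hardyRatio p := by unfold hardyRatio; positivity
  have h1 : ∀ n : ℕ, ENNReal.ofReal ((2 ^ n) ^ p⁻¹ * d (2 ^ n - 1)) ^ p =
      2 ^ n * ENNReal.ofReal (d (2 ^ n - 1)) ^ p := fun n => by
    rw [ENNReal.ofReal_mul (by positivity), ENNReal.mul_rpow_of_nonneg _ _ hp0.le,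
      ENNReal.ofReal_rpow_of_nonneg (by positivity) hp0.le, ← Real.rpow_mul (by positivity),
      inv_mul_cancel₀ hp0.ne', Real.rpow_one, ENNReal.ofReal_pow two_pos.le]
    simp
  have h2 : ∑' n : ℕ, 2 ^ n * ENNReal.ofReal (d (2 ^ n - 1)) ^ p ≤
      5 * ∑' n, ENNReal.ofReal (d n) ^ p :=
    tsum_condensed_le_five_mul_tsum (f := fun n => ENNReal.ofReal (d n) ^ p)
      fun m n hmn => ENNReal.rpow_le_rpow (ENNReal.ofReal_le_ofReal (hda hmn)) hp0.le
  have h3 : ENNReal.ofReal (sumConst p) = 30 * (1 - ENNReal.ofReal (hardyRatio p))⁻¹ ^ p := by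
    rw [sumConst, ENNReal.ofReal_mul (by norm_num), ← ENNReal.ofReal_rpow_of_nonneg
      (inv_nonneg.mpr (sub_nonneg.mpr hr.le)) hp0.le, ENNReal.ofReal_inv_of_pos (sub_pos.mpr hr),
      ENNReal.ofReal_sub _ hr0, ENNReal.ofReal_one]
    norm_num
  simp only [two_pow_mul_dyadicMean_rpow hd hp]
  calc _ ≤ 6 * ((1 - ENNReal.ofReal (hardyRatio p))⁻¹ ^ p *
        (5 * ∑' n, ENNReal.ofReal (d n) ^ p)) := by
        gcongr
        refine (tsum_sum_range_pow_mul_rpow_le _ _ hp.le).trans ?_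
        gcongr
        simpa only [h1] using h2
    _ = _ := by rw [h3]; ring

lemma tsum_ofReal_rpow_le {s d : ℕ → ℝ} (hs : ∀ n, 0 ≤ s n) (hsa : Antitone s)
    (hd : ∀ n, 0 ≤ d n) (hda : Antitone d) {p α K : ℝ} (hp : 1 < p) (hα : 0 < α) (hK : 0 ≤ K)
    (h : ∀ N, s (2 * (2 ^ N - 1)) ≤ K * dyadicMean d N ^ α) :
    ∑' n, ENNReal.ofReal (s n) ^ (p / α) ≤
      ENNReal.ofReal (K ^ (p / α)) * (ENNReal.ofReal (sumConst p) *
        ∑' n, ENNReal.ofReal (d n) ^ p) := by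
  have hp0 : 0 < p := one_pos.trans hp
  have hq : 0 < p / α := div_pos hp0 hα
  set k : ℝ≥0∞ := ENNReal.ofReal (K ^ (p / α)) with hk
  set u : ℕ → ℝ≥0∞ := fun N => 2 ^ N * ENNReal.ofReal (dyadicMean d N) ^ p with hu
  have h1 : ∀ N, ENNReal.ofReal (s (2 * (2 ^ N - 1))) ^ (p / α) ≤
      k * ENNReal.ofReal (dyadicMean d N) ^ p := fun N => by
    have h0 := dyadicMean_nonneg hd N
    rw [hk, ENNReal.ofReal_rpow_of_nonneg (hs _) hq.le, ENNReal.ofReal_rpow_of_nonneg h0 hp0.le,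
      ← ENNReal.ofReal_mul (Real.rpow_nonneg hK _)]
    refine ENNReal.ofReal_le_ofReal ((Real.rpow_le_rpow (hs _) (h N) hq.le).trans (le_of_eq ?_))
    rw [Real.mul_rpow hK (Real.rpow_nonneg h0 _), ← Real.rpow_mul h0, mul_div_cancel₀ _ hα.ne']
  have h2 : ∑' N : ℕ, 2 ^ N * ENNReal.ofReal (s (2 ^ N - 1)) ^ (p / α) ≤
      3 * (k * ∑' N, u N) := by
    rw [tsum_eq_zero_add' ENNReal.summable]
    have e0 : 2 ^ 0 * ENNReal.ofReal (s (2 ^ 0 - 1)) ^ (p / α) ≤ k * ∑' N, u N := by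
      calc _ = ENNReal.ofReal (s (2 * (2 ^ 0 - 1))) ^ (p / α) := by simp
        _ ≤ k * u 0 := by simpa [hu] using h1 0
        _ ≤ _ := by gcongr; exact ENNReal.le_tsum 0
    have e1 : ∑' N : ℕ, 2 ^ (N + 1) * ENNReal.ofReal (s (2 ^ (N + 1) - 1)) ^ (p / α) ≤
        2 * (k * ∑' N, u N) := by
      rw [← ENNReal.tsum_mul_left, ← ENNReal.tsum_mul_left]
      refine ENNReal.tsum_le_tsum fun N => ?_
      have e2 : s (2 ^ (N + 1) - 1) ≤ s (2 * (2 ^ N - 1)) := hsa (by rw [pow_succ]; omega)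
      calc _ ≤ 2 ^ (N + 1) * (k * ENNReal.ofReal (dyadicMean d N) ^ p) := by
            gcongr
            exact le_trans (by gcongr) (h1 N)
        _ = _ := by rw [hu]; ring
    calc _ ≤ k * ∑' N, u N + 2 * (k * ∑' N, u N) := add_le_add e0 e1
      _ = _ := by ring
  have h3 := tsum_le_two_mul_tsum_condensed (f := fun n => ENNReal.ofReal (s n) ^ (p / α))
      fun m n hmn => ENNReal.rpow_le_rpow (ENNReal.ofReal_le_ofReal (hsa hmn)) hq.le
  calc _ ≤ 2 * (3 * (k * ∑' N, u N)) := h3.trans (by gcongr)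
    _ = k * (6 * ∑' N, u N) := by ring
    _ ≤ _ := mul_le_mul_right (tsum_ofReal_dyadicMean_le hd hda hp) k

lemma summable_rpow_and_tsum_le_of_dyadicMean {s d : ℕ → ℝ} (hs : ∀ n, 0 ≤ s n)
    (hsa : Antitone s) (hd : ∀ n, 0 ≤ d n) (hda : Antitone d) {p α K : ℝ} (hp : 1 < p)
    (hα : 0 < α) (hK : 0 ≤ K) (h : ∀ N, s (2 * (2 ^ N - 1)) ≤ K * dyadicMean d N ^ α)
    (hsum : Summable fun n => d n ^ p) :
    Summable (fun n => s n ^ (p / α)) ∧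
      ∑' n, s n ^ (p / α) ≤ K ^ (p / α) * (sumConst p * ∑' n, d n ^ p) := by
  have hp0 : 0 < p := one_pos.trans hp
  have hq : 0 < p / α := div_pos hp0 hα
  have hc := sumConst_pos hp
  have key := tsum_ofReal_rpow_le hs hsa hd hda hp hα hK h
  simp only [ENNReal.ofReal_rpow_of_nonneg (hs _) hq.le,
    ENNReal.ofReal_rpow_of_nonneg (hd _) hp0.le] at key
  rw [← ENNReal.ofReal_tsum_of_nonneg (fun n => Real.rpow_nonneg (hd n) p) hsum,
    ← ENNReal.ofReal_mul hc.le, ← ENNReal.ofReal_mul (Real.rpow_nonneg hK _)] at key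
  have hsm : Summable fun n => s n ^ (p / α) := by
    have := ENNReal.summable_toReal (ne_top_of_le_ne_top ENNReal.ofReal_ne_top key)
    simpa only [ENNReal.toReal_ofReal (Real.rpow_nonneg (hs _) _)] using this
  refine ⟨hsm, ?_⟩
  rw [← ENNReal.ofReal_tsum_of_nonneg (fun n => Real.rpow_nonneg (hs n) _) hsm] at key
  have h0 : 0 ≤ ∑' n, d n ^ p := tsum_nonneg fun n => Real.rpow_nonneg (hd n) p
  exact (ENNReal.ofReal_le_ofReal_iff (by positivity)).mp key

end DyadicSummation

theorem stmt19 (α p : ℝ) (hα0 : 0 < α) (hα1 : α < 1) (hp : 1 < p) :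
    ∃ c : ℝ, 0 < c ∧
      ∀ (H : Type) [NormedAddCommGroup H] [InnerProductSpace ℂ H] [CompleteSpace H]
        [TopologicalSpace.SeparableSpace H],
        ∀ f : ℝ → ℂ, MemHoelder α f →
        ∀ A B Q : H →L[ℂ] H, IsSelfAdjoint A → IsSelfAdjoint B →
          MemSchatten p (A * Q - Q * B) →
            MemSchatten (p / α) (opFun f A * Q - Q * opFun f B) ∧
            schNorm (p / α) (opFun f A * Q - Q * opFun f B) ≤
              c * hoelderNorm α f * ‖Q‖ ^ (1 - α) * schNorm p (A * Q - Q * B) ^ α := by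
  have hp0 : 0 < p := one_pos.trans hp
  have hq : 0 < p / α := div_pos hp0 hα0
  have hs := sumConst_pos hp
  have hκ := quasiConst_nonneg hα1
  refine ⟨(2 * quasiConst α + 1) * sumConst p ^ (1 / (p / α)), by positivity, ?_⟩
  intro H _ _ _ _ f hf A B Q hA hB hD
  obtain ⟨hC0, hC⟩ := HoelderWith.of_memHoelder hf
  set K : ℝ := 2 * quasiConst α * hoelderNorm α f * ‖Q‖ ^ (1 - α) with hKdef
  have hK : 0 ≤ K := by positivity
  obtain ⟨h1, h2⟩ := summable_rpow_and_tsum_le_of_dyadicMean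
    (sVal_nonneg (opFun f A * Q - Q * opFun f B)) (sVal_antitone _)
    (sVal_nonneg (A * Q - Q * B)) (sVal_antitone _) hp hα0 hK
    (sVal_quasicommutator_le hα0 hα1 hC0 hA hB hC Q) hD
  refine ⟨h1, ?_⟩
  unfold schNorm
  set S : ℝ := ∑' j, sVal (A * Q - Q * B) j ^ p with hS
  have hS0 : 0 ≤ S := tsum_nonneg fun n => Real.rpow_nonneg (sVal_nonneg _ n) p
  have hT0 : 0 ≤ ∑' j, sVal (opFun f A * Q - Q * opFun f B) j ^ (p / α) :=
    tsum_nonneg fun n => Real.rpow_nonneg (sVal_nonneg _ n) _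
  have e : S ^ (1 / (p / α)) = (S ^ (1 / p)) ^ α := by
    rw [← Real.rpow_mul hS0, one_div_div, one_div_mul_eq_div]
  calc _ ≤ (K ^ (p / α) * (sumConst p * S)) ^ (1 / (p / α)) :=
        Real.rpow_le_rpow hT0 h2 (by positivity)
    _ = K * (sumConst p ^ (1 / (p / α)) * (S ^ (1 / p)) ^ α) := by
        rw [Real.mul_rpow (by positivity) (by positivity), Real.mul_rpow hs.le hS0,
          ← Real.rpow_mul hK, mul_one_div_cancel hq.ne', Real.rpow_one, e]
    _ ≤ (2 * quasiConst α + 1) * hoelderNorm α f * ‖Q‖ ^ (1 - α) *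
          (sumConst p ^ (1 / (p / α)) * (S ^ (1 / p)) ^ α) := by
        rw [hKdef]
        gcongr
        linarith
    _ = _ := by ring
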